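/- arXiv:1609.07467 — 2 statements merged into one kernel-verified Lean document; each statement's English description precedes it below -/
import Mathlib

section
/- Sub-tangent condition: Let T, δ > 0 and f ∈ C([0,T];𝒮) with n_c[f](t) ≥ δ on [0,T]. For every ε > 0 there exists h* = h*(f,ε) > 0 such that for every h ∈ (0,h*) and every t ∈ [0,T] there exists w ∈ 𝒮 with 4π ∫₀^∞ | f(t,r) + h (κ₀/n_c[f](t)) Q̂[f(t)](r) − w(r) | r² dr ≤ h ε, where Q̂[f](r) := 𝒬[f](r)/(4π r²) is the radial profile of the collision operator. Equivalently, liminf_{h→0⁺} h⁻¹ sup_{t∈[0,T]} dist( f(t) + h(κ₀/n_c[f](t)) Q̂[f(t)], 𝒮 ) = 0 in the L¹(ℝ³)-distance. -/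
open MeasureTheory Set Real Filter

/-- The collision kernel `K(x,y) = x²y²(x+y)²`. -/
noncomputable def Kker (x y : ℝ) : ℝ := x ^ 2 * y ^ 2 * (x + y) ^ 2

/-- The `k`-th line-moment `m_k⟨f⟩ = ∫₀^∞ f(r) r^k dr`. -/
noncomputable def lm (f : ℝ → ℝ) (k : ℝ) : ℝ := ∫ r in Ioi (0 : ℝ), f r * r ^ k

/-- Quadratic part of the radial collision operator (polar Jacobian included). -/
noncomputable def Qq (f : ℝ → ℝ) (r : ℝ) : ℝ :=
  8 * π ^ 2 *
    ((∫ s in (0 : ℝ)..r, Kker s (r - s) * f s * f (r - s)) +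
      2 * (∫ s in Ioi r, Kker r (s - r) * f s * f (s - r)) +
      2 * f r *
        ((∫ s in Ioi r, Kker r (s - r) * f s) -
          (∫ s in (0 : ℝ)..r, Kker s (r - s) * f s) -
          (∫ s in Ioi (0 : ℝ), Kker r s * f s)))

/-- Linear part of the radial collision operator (polar Jacobian included). -/
noncomputable def Lop (f : ℝ → ℝ) (r : ℝ) : ℝ :=
  8 * π ^ 2 *
    (2 * (∫ s in Ioi r, Kker r (s - r) * f s) -
      f r * (∫ s in (0 : ℝ)..r, Kker s (r - s)))

/-- The full radial collision operator `𝒬[f] = Q_q[f] + L[f]`. -/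
noncomputable def Qcol (f : ℝ → ℝ) (r : ℝ) : ℝ := Qq f r + Lop f r

/-- The constant `κ₀ = 9/(64 π² m)`. -/
noncomputable def kappa0 (mass : ℝ) : ℝ := 9 / (64 * π ^ 2 * mass)

/-- Membership in the bounded convex set `𝒮` determined by `𝔥₃, 𝔥₈, 𝔥∞`. -/
def memS (h3 h8 hinf : ℝ) (f : ℝ → ℝ) : Prop :=
  Measurable f ∧ (∀ r, 0 ≤ f r) ∧
  IntegrableOn (fun r => f r * r ^ (3 : ℝ)) (Ioi (0 : ℝ)) ∧ lm f 3 = h3 ∧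
  IntegrableOn (fun r => f r * r ^ (8 : ℝ)) (Ioi (0 : ℝ)) ∧ lm f 8 ≤ h8 ∧
  (∀ᵐ r ∂(volume.restrict (Ioi (0 : ℝ))), f r * r ^ 2 ≤ hinf)

/-- The `L¹(ℝ³)`-type distance on radial profiles (up to the factor `4π`). -/
noncomputable def dS (u v : ℝ → ℝ) : ℝ := ∫ r in Ioi (0 : ℝ), |u r - v r| * r ^ 2

/-- Continuity of a curve `t ↦ f(t)` with values in `𝒮` for the distance `dS`. -/
def contS (T : ℝ) (f : ℝ → ℝ → ℝ) : Prop :=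
  ∀ t₀ ∈ Icc (0 : ℝ) T, ∀ ε : ℝ, 0 < ε → ∃ η : ℝ, 0 < η ∧
    ∀ t ∈ Icc (0 : ℝ) T, |t - t₀| < η → dS (f t) (f t₀) < ε

/-- The condensate mass functional
`n_c[f](t) = √(n₀² − 2κ₀ ∫₀^t ∫₀^∞ 𝒬[f(s)](r) dr ds)`. -/
noncomputable def ncF (mass n0 : ℝ) (f : ℝ → ℝ → ℝ) (t : ℝ) : ℝ :=
  Real.sqrt (n0 ^ 2 - 2 * kappa0 mass * ∫ s in (0 : ℝ)..t, ∫ r in Ioi (0 : ℝ), Qcol (f s) r)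

namespace RadialCollision

/-- A bounded, nonnegative, measurable density on the half-line (extended by zero). -/
structure Profile (H : ℝ) (F : ℝ → ℝ) : Prop where
  meas : Measurable F
  nonneg : ∀ r, 0 ≤ F r
  le : ∀ r, F r ≤ H
  zero : ∀ r, r ≤ 0 → F r = 0

/-- The linear gain kernel. -/
noncomputable def spread (r s : ℝ) : ℝ := if r < s then (s - r) ^ 2 else 0

/-- The quadratic loss kernel. -/
noncomputable def lossKer (r s : ℝ) : ℝ := if r < s then 2 * r * s else r ^ 2 + s ^ 2

/-- Additive convolution. -/
noncomputable def conv (F G : ℝ → ℝ) (r : ℝ) : ℝ := ∫ s, F s * G (r - s)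

/-- Correlation. -/
noncomputable def corr (F G : ℝ → ℝ) (r : ℝ) : ℝ := ∫ s, F s * G (s - r)

/-- The normalized gain term. -/
noncomputable def gainOp (F : ℝ → ℝ) (r : ℝ) : ℝ :=
  if 0 < r then r ^ 2 * (conv F F r + 2 * corr F F r + 2 * ∫ s, F s * spread r s) else 0

/-- The normalized loss rate. -/
noncomputable def lossRate (F : ℝ → ℝ) (r : ℝ) : ℝ := 4 * (∫ s, F s * lossKer r s) + r ^ 5 / 30

/-- The normalized collision operator acting on densities. -/
noncomputable def coll (F : ℝ → ℝ) (r : ℝ) : ℝ := gainOp F r - F r * lossRate F r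

/-- Moments of a density on the half-line. -/
noncomputable def mom (F : ℝ → ℝ) (n : ℕ) : ℝ := ∫ s, F s * s ^ n

lemma measurable_spread : Measurable (fun z : ℝ × ℝ => spread z.1 z.2) := by
  unfold spread
  exact Measurable.ite (measurableSet_lt measurable_fst measurable_snd) (by fun_prop) (by fun_prop)

lemma measurable_lossKer : Measurable (fun z : ℝ × ℝ => lossKer z.1 z.2) := by
  unfold lossKer
  exact Measurable.ite (measurableSet_lt measurable_fst measurable_snd) (by fun_prop) (by fun_prop)

lemma spread_nonneg (r s : ℝ) : 0 ≤ spread r s := by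
  unfold spread; split_ifs <;> positivity

lemma lossKer_nonneg {r s : ℝ} (hr : 0 ≤ r) (hs : 0 ≤ s) : 0 ≤ lossKer r s := by
  unfold lossKer; split_ifs <;> positivity

lemma lossKer_le (r s : ℝ) : lossKer r s ≤ r ^ 2 + s ^ 2 := by
  unfold lossKer; split_ifs
  · nlinarith [sq_nonneg (r - s)]
  · exact le_rfl

lemma spread_le {r s : ℝ} (hr : 0 ≤ r) : spread r s ≤ s ^ 2 := by
  unfold spread; split_ifs with h
  · nlinarith
  · positivity

lemma Profile.pos_of_ne {H : ℝ} {F : ℝ → ℝ} (hF : Profile H F) {r : ℝ} (h : F r ≠ 0) : 0 < r := by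
  by_contra hr
  exact h (hF.zero r (not_lt.1 hr))

lemma Profile.measurable_gainOp {H : ℝ} {F : ℝ → ℝ} (hF : Profile H F) :
    Measurable (gainOp F) := by
  have hm := hF.meas
  have h1 : Measurable (conv F F) := by
    refine (StronglyMeasurable.integral_prod_right (f := fun r s => F s * F (r - s))
      (Measurable.stronglyMeasurable ?_)).measurable
    simp only [Function.uncurry_def]
    fun_prop
  have h2 : Measurable (corr F F) := by
    refine (StronglyMeasurable.integral_prod_right (f := fun r s => F s * F (s - r))
      (Measurable.stronglyMeasurable ?_)).measurable
    simp only [Function.uncurry_def]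
    fun_prop
  have h3 : Measurable (fun r => ∫ s, F s * spread r s) := by
    refine (StronglyMeasurable.integral_prod_right (f := fun r s => F s * spread r s)
      (Measurable.stronglyMeasurable ?_)).measurable
    simp only [Function.uncurry_def]
    exact (hm.comp measurable_snd).mul measurable_spread
  unfold gainOp
  exact Measurable.ite measurableSet_Ioi (by fun_prop) (by fun_prop)

lemma Profile.measurable_lossRate {H : ℝ} {F : ℝ → ℝ} (hF : Profile H F) :
    Measurable (lossRate F) := by
  have h3 : Measurable (fun r => ∫ s, F s * lossKer r s) := by
    refine (StronglyMeasurable.integral_prod_right (f := fun r s => F s * lossKer r s)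
      (Measurable.stronglyMeasurable ?_)).measurable
    simp only [Function.uncurry_def]
    exact (hF.meas.comp measurable_snd).mul measurable_lossKer
  unfold lossRate
  fun_prop

lemma Profile.measurable_coll {H : ℝ} {F : ℝ → ℝ} (hF : Profile H F) :
    Measurable (coll F) := by
  have h1 := hF.measurable_gainOp
  have h2 := hF.measurable_lossRate
  have h3 := hF.meas
  unfold coll
  fun_prop

lemma gainOp_nonneg {H : ℝ} {F : ℝ → ℝ} (hF : Profile H F) (r : ℝ) : 0 ≤ gainOp F r := by
  have h0 := hF.nonneg
  unfold gainOp conv corr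
  split_ifs
  · have h1 : 0 ≤ ∫ s, F s * F (r - s) := integral_nonneg fun s => mul_nonneg (h0 _) (h0 _)
    have h2 : 0 ≤ ∫ s, F s * F (s - r) := integral_nonneg fun s => mul_nonneg (h0 _) (h0 _)
    have h3 : 0 ≤ ∫ s, F s * spread r s :=
      integral_nonneg fun s => mul_nonneg (h0 _) (spread_nonneg _ _)
    positivity
  · exact le_rfl

/-! ### Weak formulation for compactly supported densities -/

lemma integrable_of_box {Φ : ℝ × ℝ → ℝ} (hm : Measurable Φ) {C b : ℝ}
    (h0 : ∀ z, Φ z ≠ 0 → z ∈ Icc (0 : ℝ) b ×ˢ Icc (0 : ℝ) b)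
    (hC : ∀ z ∈ Icc (0 : ℝ) b ×ˢ Icc (0 : ℝ) b, |Φ z| ≤ C) :
    Integrable Φ (volume.prod volume) := by
  rw [← integrableOn_iff_integrable_of_support_subset (s := Icc (0 : ℝ) b ×ˢ Icc (0 : ℝ) b)
    (fun z hz => h0 z hz)]
  refine Measure.integrableOn_of_bounded (M := C) ?_ hm.aestronglyMeasurable ?_
  · exact ((isCompact_Icc.prod isCompact_Icc).measure_lt_top).ne
  · exact (ae_restrict_iff' (measurableSet_Icc.prod measurableSet_Icc)).2 (ae_of_all _ hC)

section Truncated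

variable {H R : ℝ} {G : ℝ → ℝ}

lemma Profile.integrable_trunc (hG : Profile H G) (hR : ∀ r, R < r → G r = 0)
    {w : ℝ → ℝ} (hw : Continuous w) : Integrable (fun s => G s * w s) := by
  rw [← integrableOn_iff_integrable_of_support_subset (s := Icc (0 : ℝ) R)]
  · obtain ⟨C, hC⟩ := (isCompact_Icc (a := (0 : ℝ)) (b := R)).exists_bound_of_continuousOn
      hw.continuousOn
    refine Measure.integrableOn_of_bounded (M := H * C) isCompact_Icc.measure_lt_top.ne
      (hG.meas.mul hw.measurable).aestronglyMeasurable ?_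
    refine (ae_restrict_iff' measurableSet_Icc).2 (ae_of_all _ fun s hs => ?_)
    rw [norm_mul, Real.norm_of_nonneg (hG.nonneg s)]
    exact mul_le_mul (hG.le s) (hC s hs) (norm_nonneg _) ((hG.nonneg s).trans (hG.le s))
  · intro s hs
    have h : G s ≠ 0 := left_ne_zero_of_mul hs
    exact ⟨(hG.pos_of_ne h).le, not_lt.1 fun h' => h (hR s h')⟩

lemma Profile.integrable_pair (hG : Profile H G) (hR : ∀ r, R < r → G r = 0)
    {p : ℝ × ℝ → ℝ} (hp : Measurable p) {C : ℝ}
    (hC : ∀ z ∈ Icc (0 : ℝ) R ×ˢ Icc (0 : ℝ) R, |p z| ≤ C) :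
    Integrable (fun z : ℝ × ℝ => G z.1 * G z.2 * p z) (volume.prod volume) := by
  have hm := hG.meas
  refine integrable_of_box (b := R) (C := H * H * C) (by fun_prop) ?_ ?_
  · intro z hz
    have h1 : G z.1 ≠ 0 := left_ne_zero_of_mul (left_ne_zero_of_mul hz)
    have h2 : G z.2 ≠ 0 := right_ne_zero_of_mul (left_ne_zero_of_mul hz)
    exact ⟨⟨(hG.pos_of_ne h1).le, not_lt.1 fun h' => h1 (hR _ h')⟩,
      ⟨(hG.pos_of_ne h2).le, not_lt.1 fun h' => h2 (hR _ h')⟩⟩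
  · intro z hz
    have hH : 0 ≤ H := (hG.nonneg 0).trans (hG.le 0)
    rw [abs_mul, abs_mul, abs_of_nonneg (hG.nonneg _), abs_of_nonneg (hG.nonneg _)]
    exact mul_le_mul (mul_le_mul (hG.le _) (hG.le _) (hG.nonneg _) hH) (hC z hz) (abs_nonneg _)
      (by positivity)

lemma Profile.conv_moment (hG : Profile H G) (hR : ∀ r, R < r → G r = 0) (n : ℕ) :
    Integrable (fun r => r ^ n * conv G G r) ∧
    ∫ r, r ^ n * conv G G r =
      ∫ z : ℝ × ℝ, G z.1 * G z.2 * (z.1 + z.2) ^ n ∂(volume.prod volume) := by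
  have hm := hG.meas
  have hH : 0 ≤ H := (hG.nonneg 0).trans (hG.le 0)
  have hint : Integrable (fun z : ℝ × ℝ => z.1 ^ n * (G z.2 * G (z.1 - z.2)))
      (volume.prod volume) := by
    refine integrable_of_box (b := 2 * R) (C := (2 * R) ^ n * (H * H)) (by fun_prop) ?_ ?_
    · intro z hz
      have h1 : G z.2 ≠ 0 := left_ne_zero_of_mul (right_ne_zero_of_mul hz)
      have h2 : G (z.1 - z.2) ≠ 0 := right_ne_zero_of_mul (right_ne_zero_of_mul hz)
      have a1 := hG.pos_of_ne h1
      have a2 := hG.pos_of_ne h2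
      have b1 : z.2 ≤ R := not_lt.1 fun h' => h1 (hR _ h')
      have b2 : z.1 - z.2 ≤ R := not_lt.1 fun h' => h2 (hR _ h')
      refine ⟨⟨?_, ?_⟩, ?_, ?_⟩ <;> linarith
    · rintro z ⟨⟨hz1, hz2⟩, -⟩
      rw [abs_mul, abs_mul, abs_of_nonneg (hG.nonneg _), abs_of_nonneg (hG.nonneg _),
        abs_of_nonneg (pow_nonneg hz1 n)]
      exact mul_le_mul (pow_le_pow_left₀ hz1 hz2 n)
        (mul_le_mul (hG.le _) (hG.le _) (hG.nonneg _) hH)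
        (mul_nonneg (hG.nonneg _) (hG.nonneg _)) (pow_nonneg (hz1.trans hz2) n)
  have h1 := hint.integral_prod_left
  simp only [integral_const_mul] at h1
  refine ⟨h1, ?_⟩
  have hp : Integrable (fun z : ℝ × ℝ => G z.1 * G z.2 * (z.1 + z.2) ^ n)
      (volume.prod volume) := by
    refine hG.integrable_pair hR (C := (R + R) ^ n) (by fun_prop) ?_
    rintro z ⟨⟨h1, h2⟩, h3, h4⟩
    rw [abs_of_nonneg (by positivity)]
    gcongr
  unfold conv
  simp only [← integral_const_mul]
  rw [integral_integral_swap hint, integral_prod _ hp]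
  congr 1; ext s
  rw [← integral_sub_right_eq_self (fun u => G s * G u * (s + u) ^ n) s]
  congr 1; ext r
  rw [add_sub_cancel]; ring

lemma Profile.corr_moment (hG : Profile H G) (hR : ∀ r, R < r → G r = 0) (n : ℕ) :
    Integrable (fun r => if 0 < r then r ^ n * corr G G r else 0) ∧
    ∫ r, (if 0 < r then r ^ n * corr G G r else 0) =
      ∫ z : ℝ × ℝ, G z.1 * G z.2 * (if z.2 < z.1 then (z.1 - z.2) ^ n else 0)
        ∂(volume.prod volume) := by
  have hm := hG.meas
  have hH : 0 ≤ H := (hG.nonneg 0).trans (hG.le 0)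
  have hint : Integrable (fun z : ℝ × ℝ => (if 0 < z.1 then z.1 ^ n else 0) *
      (G z.2 * G (z.2 - z.1))) (volume.prod volume) := by
    refine integrable_of_box (b := R) (C := R ^ n * (H * H)) ?_ ?_ ?_
    · refine Measurable.mul (Measurable.ite ?_ (by fun_prop) (by fun_prop)) (by fun_prop)
      exact measurableSet_lt measurable_const measurable_fst
    · intro z hz
      have h0 : 0 < z.1 := by
        by_contra h
        simp [h] at hz
      have h1 : G z.2 ≠ 0 := left_ne_zero_of_mul (right_ne_zero_of_mul hz)
      have h2 : G (z.2 - z.1) ≠ 0 := right_ne_zero_of_mul (right_ne_zero_of_mul hz)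
      have a1 := hG.pos_of_ne h1
      have a2 := hG.pos_of_ne h2
      have b1 : z.2 ≤ R := not_lt.1 fun h' => h1 (hR _ h')
      refine ⟨⟨?_, ?_⟩, ?_, ?_⟩ <;> linarith
    · rintro z ⟨⟨hz1, hz2⟩, -⟩
      have : 0 ≤ (if 0 < z.1 then z.1 ^ n else 0) ∧ (if 0 < z.1 then z.1 ^ n else 0) ≤ R ^ n := by
        split_ifs
        · exact ⟨pow_nonneg hz1 n, pow_le_pow_left₀ hz1 hz2 n⟩
        · exact ⟨le_rfl, pow_nonneg (hz1.trans hz2) n⟩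
      rw [abs_mul, abs_mul, abs_of_nonneg (hG.nonneg _), abs_of_nonneg (hG.nonneg _),
        abs_of_nonneg this.1]
      exact mul_le_mul this.2
        (mul_le_mul (hG.le _) (hG.le _) (hG.nonneg _) hH)
        (mul_nonneg (hG.nonneg _) (hG.nonneg _)) (pow_nonneg (hz1.trans hz2) n)
  have h1 := hint.integral_prod_left
  simp only [integral_const_mul] at h1
  have e : (fun r => if 0 < r then r ^ n * corr G G r else 0) =
      fun r => (if 0 < r then r ^ n else 0) * corr G G r := by
    ext r; split_ifs <;> simp
  rw [e]
  refine ⟨h1, ?_⟩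
  have hp : Integrable (fun z : ℝ × ℝ => G z.1 * G z.2 *
      (if z.2 < z.1 then (z.1 - z.2) ^ n else 0)) (volume.prod volume) := by
    refine hG.integrable_pair hR (C := R ^ n) ?_ ?_
    · refine Measurable.ite ?_ (by fun_prop) (by fun_prop)
      exact measurableSet_lt measurable_snd measurable_fst
    rintro z ⟨⟨h1, h2⟩, h3, h4⟩
    have hR0 : 0 ≤ R := h1.trans h2
    split_ifs with h
    · have : 0 ≤ z.1 - z.2 := by linarith
      rw [abs_of_nonneg (by positivity)]
      gcongr
      linarith
    · simpa using pow_nonneg hR0 n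
  unfold corr
  simp only [← integral_const_mul]
  rw [integral_integral_swap hint, integral_prod _ hp]
  congr 1; ext s
  rw [← integral_sub_left_eq_self _ _ s]
  congr 1; ext r
  simp only [sub_pos, sub_sub_cancel]; ring

lemma integral_spread_pow (n : ℕ) {s : ℝ} (hs : 0 ≤ s) :
    Integrable (fun r => (if 0 < r then r ^ n else 0) * spread r s) ∧
    ∫ r, (if 0 < r then r ^ n else 0) * spread r s =
      s ^ (n + 3) * (1 / (n + 1) - 2 / (n + 2) + 1 / (n + 3)) := by
  have h1 : (fun r => (if 0 < r then r ^ n else 0) * spread r s) =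
      (Ioo 0 s).indicator (fun r => s ^ 2 * r ^ n - 2 * s * r ^ (n + 1) + r ^ (n + 2)) := by
    ext r
    unfold spread
    by_cases h0 : 0 < r <;> by_cases h2 : r < s <;> simp [h0, h2, indicator]
    ring
  rw [h1]
  constructor
  · rw [integrable_indicator_iff measurableSet_Ioo]
    refine IntegrableOn.mono_set (ContinuousOn.integrableOn_compact isCompact_Icc ?_)
      Ioo_subset_Icc_self
    fun_prop
  rw [integral_indicator measurableSet_Ioo, ← integral_Ioc_eq_integral_Ioo,
    ← intervalIntegral.integral_of_le hs, intervalIntegral.integral_add,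
    intervalIntegral.integral_sub, intervalIntegral.integral_const_mul,
    intervalIntegral.integral_const_mul, integral_pow, integral_pow, integral_pow]
  · push_cast
    simp only [ne_eq, Nat.add_eq_zero_iff, one_ne_zero, and_false, not_false_eq_true, zero_pow,
      sub_zero, OfNat.ofNat_ne_zero]
    field_simp
    ring
  all_goals apply Continuous.intervalIntegrable; fun_prop

lemma Profile.spread_moment (hG : Profile H G) (n : ℕ)
    (hi : Integrable fun s => G s * s ^ (n + 3)) :
    Integrable (fun r => if 0 < r then r ^ n * ∫ s, G s * spread r s else 0) ∧
    ∫ r, (if 0 < r then r ^ n * ∫ s, G s * spread r s else 0) =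
      (∫ s, G s * s ^ (n + 3)) * (1 / (n + 1) - 2 / (n + 2) + 1 / (n + 3)) := by
  have hm := hG.meas
  have hslice (s : ℝ) : Integrable (fun r => (if 0 < r then r ^ n else 0) *
      (G s * spread r s)) ∧ ∫ r, (if 0 < r then r ^ n else 0) * (G s * spread r s) =
        G s * s ^ (n + 3) * (1 / (n + 1) - 2 / (n + 2) + 1 / (n + 3)) := by
    rcases le_or_gt s 0 with hs | hs
    · simp [hG.zero s hs]
    · obtain ⟨a, b⟩ := integral_spread_pow n hs.le
      have e : (fun r => (if 0 < r then r ^ n else 0) * (G s * spread r s)) =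
          fun r => G s * ((if 0 < r then r ^ n else 0) * spread r s) := by
        ext r; ring
      rw [e]
      exact ⟨a.const_mul _, by rw [integral_const_mul, b, mul_assoc]⟩
  have hint : Integrable (fun z : ℝ × ℝ => (if 0 < z.1 then z.1 ^ n else 0) *
      (G z.2 * spread z.1 z.2)) (volume.prod volume) := by
    rw [integrable_prod_iff']
    · refine ⟨ae_of_all _ fun s => (hslice s).1, ?_⟩
      have e : (fun s => ∫ r, ‖(if 0 < r then r ^ n else 0) * (G s * spread r s)‖) =
          fun s => G s * s ^ (n + 3) * (1 / (n + 1) - 2 / (n + 2) + 1 / (n + 3)) := by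
        ext s
        rw [← (hslice s).2]
        congr 1; ext r
        refine Real.norm_of_nonneg (mul_nonneg ?_ (mul_nonneg (hG.nonneg s) (spread_nonneg r s)))
        split_ifs <;> positivity
      rw [e]
      exact hi.mul_const _
    · refine (Measurable.mul (Measurable.ite ?_ (by fun_prop) (by fun_prop))
        ((hm.comp measurable_snd).mul measurable_spread)).aestronglyMeasurable
      exact measurableSet_lt measurable_const measurable_fst
  have h1 := hint.integral_prod_left
  simp only [integral_const_mul] at h1
  have e : (fun r => if 0 < r then r ^ n * ∫ s, G s * spread r s else 0) =
      fun r => (if 0 < r then r ^ n else 0) * ∫ s, G s * spread r s := by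
    ext r; split_ifs <;> simp
  rw [e]
  refine ⟨h1, ?_⟩
  simp only [← integral_const_mul]
  rw [integral_integral_swap hint, ← integral_mul_const]
  congr 1; ext s
  exact (hslice s).2

lemma Profile.loss_moment (hG : Profile H G) (hR : ∀ r, R < r → G r = 0) (n : ℕ) :
    Integrable (fun r => r ^ n * (G r * ∫ s, G s * lossKer r s)) ∧
    ∫ r, r ^ n * (G r * ∫ s, G s * lossKer r s) =
      ∫ z : ℝ × ℝ, G z.1 * G z.2 * (z.1 ^ n * lossKer z.1 z.2) ∂(volume.prod volume) := by
  have hp : Integrable (fun z : ℝ × ℝ => G z.1 * G z.2 * (z.1 ^ n * lossKer z.1 z.2))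
      (volume.prod volume) := by
    refine hG.integrable_pair hR (C := R ^ n * (R ^ 2 + R ^ 2)) ?_ ?_
    · exact (measurable_fst.pow_const n).mul measurable_lossKer
    rintro z ⟨⟨h1, h2⟩, h3, h4⟩
    have hk := lossKer_nonneg h1 h3
    rw [abs_of_nonneg (by positivity)]
    exact mul_le_mul (pow_le_pow_left₀ h1 h2 n)
      ((lossKer_le z.1 z.2).trans (by gcongr)) hk (pow_nonneg (h1.trans h2) n)
  have e : (fun r => r ^ n * (G r * ∫ s, G s * lossKer r s)) =
      fun r => ∫ s, G r * G s * (r ^ n * lossKer r s) := by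
    ext r
    rw [← integral_const_mul, ← integral_const_mul]
    congr 1; ext s; ring
  rw [e]
  exact ⟨hp.integral_prod_left, (integral_prod _ hp).symm⟩

end Truncated

section TruncatedMoments

variable {H R : ℝ} {G : ℝ → ℝ}

lemma Profile.conv_eq_zero (hG : Profile H G) {r : ℝ} (hr : r ≤ 0) : conv G G r = 0 := by
  unfold conv
  refine integral_eq_zero_of_ae (ae_of_all _ fun s => ?_)
  rcases le_or_gt s 0 with hs | hs
  · simp [hG.zero s hs]
  · simp [hG.zero (r - s) (by linarith)]

/-- The weight of a pair of energies in the weak form of the quadratic part tested with `r ^ m`. -/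
noncomputable def pairWeight (m : ℕ) (z : ℝ × ℝ) : ℝ :=
  (z.1 + z.2) ^ (m + 2) + 2 * (if z.2 < z.1 then (z.1 - z.2) ^ (m + 2) else 0) -
    4 * (z.1 ^ m * lossKer z.1 z.2)

lemma Profile.integrable_pairWeight (hG : Profile H G) (hR : ∀ r, R < r → G r = 0) (m : ℕ) :
    Integrable (fun z : ℝ × ℝ => G z.1 * G z.2 * (z.1 + z.2) ^ (m + 2)) (volume.prod volume) ∧
    Integrable (fun z : ℝ × ℝ => G z.1 * G z.2 *
      (if z.2 < z.1 then (z.1 - z.2) ^ (m + 2) else 0)) (volume.prod volume) ∧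
    Integrable (fun z : ℝ × ℝ => G z.1 * G z.2 * (z.1 ^ m * lossKer z.1 z.2))
      (volume.prod volume) := by
  refine ⟨hG.integrable_pair hR (C := (R + R) ^ (m + 2)) (by fun_prop) ?_,
    hG.integrable_pair hR (C := R ^ (m + 2)) ?_ ?_,
    hG.integrable_pair hR (C := R ^ m * (R ^ 2 + R ^ 2)) ?_ ?_⟩
  · rintro z ⟨⟨h1, h2⟩, h3, h4⟩
    rw [abs_of_nonneg (by positivity)]
    gcongr
  · refine Measurable.ite ?_ (by fun_prop) (by fun_prop)
    exact measurableSet_lt measurable_snd measurable_fst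
  · rintro z ⟨⟨h1, h2⟩, h3, h4⟩
    have hR0 : 0 ≤ R := h1.trans h2
    split_ifs with h
    · have : 0 ≤ z.1 - z.2 := by linarith
      rw [abs_of_nonneg (by positivity)]
      gcongr
      linarith
    · simpa using pow_nonneg hR0 (m + 2)
  · exact (measurable_fst.pow_const m).mul measurable_lossKer
  · rintro z ⟨⟨h1, h2⟩, h3, h4⟩
    have hk := lossKer_nonneg h1 h3
    rw [abs_of_nonneg (by positivity)]
    exact mul_le_mul (pow_le_pow_left₀ h1 h2 m)
      ((lossKer_le z.1 z.2).trans (by gcongr)) hk (pow_nonneg (h1.trans h2) m)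

lemma Profile.coll_moment (hG : Profile H G) (hR : ∀ r, R < r → G r = 0) (m : ℕ) :
    Integrable (fun r => coll G r * r ^ m) ∧
    Integrable (fun z : ℝ × ℝ => G z.1 * G z.2 * pairWeight m z) (volume.prod volume) ∧
    ∫ r, coll G r * r ^ m =
      ∫ z : ℝ × ℝ, G z.1 * G z.2 * pairWeight m z ∂(volume.prod volume) +
      mom G (m + 5) * (2 * (1 / (m + 3) - 2 / (m + 4) + 1 / (m + 5)) - 1 / 30) := by
  obtain ⟨i1, e1⟩ := hG.conv_moment hR (m + 2)
  obtain ⟨i2, e2⟩ := hG.corr_moment hR (m + 2)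
  obtain ⟨i3, e3⟩ := hG.spread_moment (m + 2) (hG.integrable_trunc hR (by fun_prop))
  obtain ⟨i4, e4⟩ := hG.loss_moment hR m
  have i5 : Integrable (fun s => G s * s ^ (m + 5)) := hG.integrable_trunc hR (by fun_prop)
  obtain ⟨j1, j2, j3⟩ := hG.integrable_pairWeight hR m
  have hpt : (fun r => coll G r * r ^ m) = fun r =>
      r ^ (m + 2) * conv G G r + 2 * (if 0 < r then r ^ (m + 2) * corr G G r else 0) +
        2 * (if 0 < r then r ^ (m + 2) * ∫ s, G s * spread r s else 0) -
        4 * (r ^ m * (G r * ∫ s, G s * lossKer r s)) - G r * r ^ (m + 5) * (1 / 30) := by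
    ext r
    unfold coll gainOp lossRate
    split_ifs with h
    · ring
    · rw [hG.conv_eq_zero (not_lt.1 h), hG.zero r (not_lt.1 h)]; ring
  have hw : (fun z : ℝ × ℝ => G z.1 * G z.2 * pairWeight m z) = fun z =>
      G z.1 * G z.2 * (z.1 + z.2) ^ (m + 2) +
      2 * (G z.1 * G z.2 * (if z.2 < z.1 then (z.1 - z.2) ^ (m + 2) else 0)) -
      4 * (G z.1 * G z.2 * (z.1 ^ m * lossKer z.1 z.2)) := by
    ext z; unfold pairWeight; ring
  have k1 : Integrable fun r => r ^ (m + 2) * conv G G r +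
      2 * (if 0 < r then r ^ (m + 2) * corr G G r else 0) := i1.add (i2.const_mul 2)
  have k2 : Integrable fun r => r ^ (m + 2) * conv G G r +
      2 * (if 0 < r then r ^ (m + 2) * corr G G r else 0) +
      2 * (if 0 < r then r ^ (m + 2) * ∫ s, G s * spread r s else 0) :=
    k1.add (i3.const_mul 2)
  have k3 : Integrable fun r => r ^ (m + 2) * conv G G r +
      2 * (if 0 < r then r ^ (m + 2) * corr G G r else 0) +
      2 * (if 0 < r then r ^ (m + 2) * ∫ s, G s * spread r s else 0) -
      4 * (r ^ m * (G r * ∫ s, G s * lossKer r s)) := k2.sub (i4.const_mul 4)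
  have l1 : Integrable (fun z : ℝ × ℝ => G z.1 * G z.2 * (z.1 + z.2) ^ (m + 2) +
      2 * (G z.1 * G z.2 * (if z.2 < z.1 then (z.1 - z.2) ^ (m + 2) else 0)))
      (volume.prod volume) := j1.add (j2.const_mul 2)
  refine ⟨?_, ?_, ?_⟩
  · rw [hpt]; exact k3.sub (i5.mul_const _)
  · rw [hw]; exact l1.sub (j3.const_mul 4)
  · rw [hpt, hw]
    rw [integral_sub k3 (i5.mul_const _), integral_sub k2 (i4.const_mul 4),
      integral_add k1 (i3.const_mul 2), integral_add i1 (i2.const_mul 2),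
      integral_sub l1 (j3.const_mul 4), integral_add j1 (j2.const_mul 2)]
    simp only [integral_const_mul, integral_mul_const]
    rw [e1, e2, e3, e4]
    unfold mom
    push_cast
    ring

lemma pairWeight_one_symm {z : ℝ × ℝ} :
    pairWeight 1 z + pairWeight 1 z.swap = 0 := by
  unfold pairWeight lossKer
  simp only [Prod.fst_swap, Prod.snd_swap]
  rcases lt_trichotomy z.1 z.2 with h | h | h
  · simp only [h, not_lt.2 h.le, if_true, if_false]; ring
  · simp only [h, lt_irrefl, if_false]; ring
  · simp only [h, not_lt.2 h.le, if_true, if_false]; ring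

lemma pairWeight_six_symm {z : ℝ × ℝ} (h1 : 0 ≤ z.1) (h2 : 0 ≤ z.2) :
    pairWeight 6 z + pairWeight 6 z.swap ≤ 504 * (z.1 ^ 7 * z.2 + z.1 * z.2 ^ 7) := by
  have key : ∀ s u : ℝ, 0 ≤ u → u ≤ s →
      2 * (s + u) ^ 8 + 2 * (s - u) ^ 8 - 4 * (s ^ 6 * (s ^ 2 + u ^ 2)) - 4 * (u ^ 6 * (2 * u * s))
        ≤ 504 * (s ^ 7 * u) := by
    intro s u hu hus
    have hs : 0 ≤ s := hu.trans hus
    have a1 : s ^ 6 * u ^ 2 ≤ s ^ 7 * u := by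
      have := mul_le_mul_of_nonneg_left hus (show 0 ≤ s ^ 6 * u by positivity)
      nlinarith
    have a2 : s ^ 4 * u ^ 4 ≤ s ^ 7 * u := by
      have := mul_le_mul_of_nonneg_left (pow_le_pow_left₀ hu hus 3)
        (show 0 ≤ s ^ 4 * u by positivity)
      nlinarith
    have a3 : s ^ 2 * u ^ 6 ≤ s ^ 7 * u := by
      have := mul_le_mul_of_nonneg_left (pow_le_pow_left₀ hu hus 5)
        (show 0 ≤ s ^ 2 * u by positivity)
      nlinarith
    have a4 : u ^ 8 ≤ s ^ 7 * u := by
      have := mul_le_mul_of_nonneg_left (pow_le_pow_left₀ hu hus 7) hu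
      nlinarith
    have a5 : 0 ≤ u ^ 7 * s := by positivity
    have a6 : 0 ≤ s ^ 7 * u := by positivity
    have : 2 * (s + u) ^ 8 + 2 * (s - u) ^ 8 - 4 * (s ^ 6 * (s ^ 2 + u ^ 2)) -
        4 * (u ^ 6 * (2 * u * s)) = 108 * (s ^ 6 * u ^ 2) + 280 * (s ^ 4 * u ^ 4) +
          112 * (s ^ 2 * u ^ 6) + 4 * u ^ 8 - 8 * (u ^ 7 * s) := by ring
    linarith
  have b1 : 0 ≤ z.1 ^ 7 * z.2 := by positivity
  have b2 : 0 ≤ z.1 * z.2 ^ 7 := by positivity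
  unfold pairWeight lossKer
  simp only [Prod.fst_swap, Prod.snd_swap]
  rcases lt_trichotomy z.1 z.2 with h | h | h
  · simp only [h, not_lt.2 h.le, if_true, if_false, Nat.reduceAdd]
    have := key z.2 z.1 h1 h.le
    linarith
  · have := key z.2 z.1 h1 h.le
    simp only [h, lt_irrefl, if_false, Nat.reduceAdd] at *
    linarith
  · simp only [h, not_lt.2 h.le, if_true, if_false, Nat.reduceAdd]
    have := key z.1 z.2 h2 h.le
    linarith

lemma Profile.integral_pair_symm
    {p : ℝ × ℝ → ℝ} (hp : Integrable (fun z : ℝ × ℝ => G z.1 * G z.2 * p z) (volume.prod volume)) :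
    Integrable (fun z : ℝ × ℝ => G z.1 * G z.2 * (p z + p z.swap)) (volume.prod volume) ∧
    2 * ∫ z : ℝ × ℝ, G z.1 * G z.2 * p z ∂(volume.prod volume) =
      ∫ z : ℝ × ℝ, G z.1 * G z.2 * (p z + p z.swap) ∂(volume.prod volume) := by
  have hs := hp.swap
  have e : (fun z : ℝ × ℝ => G z.1 * G z.2 * (p z + p z.swap)) = fun z =>
      G z.1 * G z.2 * p z + ((fun z : ℝ × ℝ => G z.1 * G z.2 * p z) ∘ Prod.swap) z := by
    ext z
    simp only [Function.comp, Prod.fst_swap, Prod.snd_swap]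
    ring
  rw [e]
  refine ⟨hp.add hs, ?_⟩
  rw [integral_add hp hs]
  simp only [Function.comp]
  rw [integral_prod_swap (fun z : ℝ × ℝ => G z.1 * G z.2 * p z)]
  ring

/-- Conservation of energy. -/
lemma Profile.coll_energy (hG : Profile H G) (hR : ∀ r, R < r → G r = 0) :
    Integrable (fun r => coll G r * r) ∧ ∫ r, coll G r * r = 0 := by
  obtain ⟨h1, h2, h3⟩ := hG.coll_moment hR 1
  obtain ⟨-, h5⟩ := Profile.integral_pair_symm h2
  simp only [pow_one] at h1 h3
  refine ⟨h1, ?_⟩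
  simp only [pairWeight_one_symm, mul_zero, integral_zero] at h5
  have : ∫ z : ℝ × ℝ, G z.1 * G z.2 * pairWeight 1 z ∂(volume.prod volume) = 0 := by linarith
  rw [h3, this]
  norm_num

/-- Production of the sixth moment of the density: the linear loss dominates. -/
lemma Profile.coll_sixth (hG : Profile H G) (hR : ∀ r, R < r → G r = 0) :
    Integrable (fun r => coll G r * r ^ 6) ∧
      ∫ r, coll G r * r ^ 6 ≤ 504 * (mom G 7 * mom G 1) - 29 / 990 * mom G 11 := by
  obtain ⟨h1, h2, h3⟩ := hG.coll_moment hR 6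
  obtain ⟨h4, h5⟩ := Profile.integral_pair_symm h2
  refine ⟨h1, ?_⟩
  have m7 : Integrable (fun s => G s * s ^ 7) := hG.integrable_trunc hR (by fun_prop)
  have m1 : Integrable (fun s => G s * s ^ 1) := hG.integrable_trunc hR (by fun_prop)
  have q1 := (m7.mul_prod m1).const_mul 504
  have q2 := (m1.mul_prod m7).const_mul 504
  have hle : ∫ z : ℝ × ℝ, G z.1 * G z.2 * (pairWeight 6 z + pairWeight 6 z.swap)
      ∂(volume.prod volume) ≤ ∫ z : ℝ × ℝ, (504 * (G z.1 * z.1 ^ 7 * (G z.2 * z.2 ^ 1)) +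
        504 * (G z.1 * z.1 ^ 1 * (G z.2 * z.2 ^ 7))) ∂(volume.prod volume) := by
    refine integral_mono h4 (q1.add q2) fun z => ?_
    dsimp only
    rcases le_or_gt z.1 0 with a | a
    · simp [hG.zero _ a]
    rcases le_or_gt z.2 0 with b | b
    · simp [hG.zero _ b]
    have := mul_le_mul_of_nonneg_left (pairWeight_six_symm a.le b.le)
      (mul_nonneg (hG.nonneg z.1) (hG.nonneg z.2))
    linarith
  rw [integral_add q1 q2, integral_const_mul, integral_const_mul,
    integral_prod_mul (fun s => G s * s ^ 7) (fun s => G s * s ^ 1),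
    integral_prod_mul (fun s => G s * s ^ 1) (fun s => G s * s ^ 7)] at hle
  rw [h3]
  norm_num
  unfold mom
  nlinarith

lemma mom_nonneg (hG : Profile H G) (n : ℕ) : 0 ≤ mom G n := by
  refine integral_nonneg fun s => ?_
  rcases le_or_gt s 0 with a | a
  · simp [hG.zero _ a]
  · exact mul_nonneg (hG.nonneg s) (by positivity)

lemma Profile.coll_sixth_le (hG : Profile H G) (hR : ∀ r, R < r → G r = 0) {E : ℝ} (hE : 0 < E)
    (h1 : mom G 1 ≤ E) :
    ∫ r, coll G r * r ^ 6 ≤ 504 * (1 + 40320 * E) ^ 6 * E ^ 2 - mom G 11 / 80 ∧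
      mom G 6 ≤ mom G 11 + E := by
  have m1 : Integrable (fun s => G s * s ^ 1) := hG.integrable_trunc hR (by fun_prop)
  have m6 : Integrable (fun s => G s * s ^ 6) := hG.integrable_trunc hR (by fun_prop)
  have m7 : Integrable (fun s => G s * s ^ 7) := hG.integrable_trunc hR (by fun_prop)
  have m11 : Integrable (fun s => G s * s ^ 11) := hG.integrable_trunc hR (by fun_prop)
  set B : ℝ := 1 + 40320 * E with hB
  have hB1 : 1 ≤ B := by rw [hB]; linarith
  have i7 : B ^ 4 * mom G 7 ≤ mom G 11 + B ^ 10 * mom G 1 := by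
    unfold mom
    rw [← integral_const_mul, ← integral_const_mul, ← integral_add m11 (m1.const_mul _)]
    refine integral_mono (m7.const_mul _) (m11.add (m1.const_mul _)) fun s => ?_
    dsimp only
    rcases le_or_gt s 0 with a | a
    · simp [hG.zero _ a]
    have : B ^ 4 * s ^ 7 ≤ s ^ 11 + B ^ 10 * s := by
      rcases le_total B s with h | h
      · have := mul_le_mul_of_nonneg_right (pow_le_pow_left₀ (by linarith) h 4)
          (show 0 ≤ s ^ 7 by positivity)
        have : 0 ≤ B ^ 10 * s := by positivity
        nlinarith
      · have := mul_le_mul_of_nonneg_right (pow_le_pow_left₀ a.le h 6)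
          (show 0 ≤ B ^ 4 * s by positivity)
        have : 0 ≤ s ^ 11 := by positivity
        nlinarith
    have := mul_le_mul_of_nonneg_left this (hG.nonneg s)
    linarith
  have i6 : mom G 6 ≤ mom G 11 + mom G 1 := by
    unfold mom
    rw [← integral_add m11 m1]
    refine integral_mono m6 (m11.add m1) fun s => ?_
    dsimp only
    rcases le_or_gt s 0 with a | a
    · simp [hG.zero _ a]
    have : s ^ 6 ≤ s ^ 11 + s ^ 1 := by
      rcases le_total 1 s with h | h
      · have := pow_le_pow_right₀ h (show 6 ≤ 11 by norm_num)
        nlinarith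
      · have := pow_le_pow_of_le_one a.le h (show 1 ≤ 6 by norm_num)
        have : 0 ≤ s ^ 11 := by positivity
        linarith
    have := mul_le_mul_of_nonneg_left this (hG.nonneg s)
    linarith
  refine ⟨?_, i6.trans (by linarith)⟩
  have hc := (hG.coll_sixth hR).2
  have n1 := mom_nonneg hG 1
  have n7 := mom_nonneg hG 7
  have n11 := mom_nonneg hG 11
  have hB4 : 40320 * E ≤ B ^ 4 := by
    calc 40320 * E ≤ B ^ 1 := by rw [hB]; linarith
      _ ≤ B ^ 4 := pow_le_pow_right₀ hB1 (by norm_num)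
  have k1 : mom G 7 ≤ mom G 11 / B ^ 4 + B ^ 6 * mom G 1 := by
    have hpos : 0 < B ^ 4 := by positivity
    rw [← sub_nonneg]
    have : mom G 11 / B ^ 4 + B ^ 6 * mom G 1 - mom G 7 =
        (mom G 11 + B ^ 10 * mom G 1 - B ^ 4 * mom G 7) / B ^ 4 := by
      field_simp
    rw [this]
    exact div_nonneg (by linarith) hpos.le
  have k2 : mom G 7 * mom G 1 ≤ (mom G 11 / B ^ 4 + B ^ 6 * E) * E := by
    refine mul_le_mul (k1.trans ?_) h1 n1 (by positivity)
    gcongr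
  have k3 : 504 * (mom G 11 / B ^ 4 * E) ≤ mom G 11 / 80 := by
    rw [div_mul_eq_mul_div, ← mul_div_assoc, div_le_div_iff₀ (by positivity) (by norm_num)]
    nlinarith
  nlinarith

end TruncatedMoments

/-- A profile whose moments up to order six are finite and bounded by `N`. -/
structure FiniteProfile (H N : ℝ) (F : ℝ → ℝ) : Prop extends Profile H F where
  int : ∀ n ≤ 6, Integrable fun s => F s * s ^ n
  mom_le : ∀ n ≤ 6, mom F n ≤ N

lemma conv_integral {a b : ℝ → ℝ} (ha : Integrable a) (hb : Integrable b) :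
    Integrable (conv a b) ∧ ∫ r, conv a b r = (∫ s, a s) * ∫ s, b s :=
  ⟨ha.integrable_convolution (ContinuousLinearMap.mul ℝ ℝ) hb,
    integral_convolution (ContinuousLinearMap.mul ℝ ℝ) ha hb⟩

lemma corr_integral {a b : ℝ → ℝ} (ha : Integrable a) (hb : Integrable b) :
    Integrable (corr a b) ∧ ∫ r, corr a b r = (∫ s, a s) * ∫ s, b s := by
  have e : corr a b = conv a (fun x => b (-x)) := by
    ext r
    unfold corr conv
    congr 1; ext s
    simp only [neg_sub]
  have h := conv_integral ha hb.comp_neg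
  rw [integral_neg_eq_self b] at h
  rw [e]
  exact h

lemma Profile.integrable_mul_sub_left {H : ℝ} {F a : ℝ → ℝ} (hF : Profile H F)
    (ha : Integrable a) (r : ℝ) : Integrable fun s => a s * F (r - s) := by
  have hm := hF.meas
  have := ha.bdd_mul (f := fun s => F (r - s)) (c := H)
    (by fun_prop : Measurable fun s => F (r - s)).aestronglyMeasurable
    (ae_of_all _ fun s => by rw [Real.norm_of_nonneg (hF.nonneg _)]; exact hF.le _)
  exact this.congr (ae_of_all _ fun s => mul_comm _ _)

lemma Profile.integrable_mul_sub_right {H : ℝ} {F a : ℝ → ℝ} (hF : Profile H F)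
    (ha : Integrable a) (r : ℝ) : Integrable fun s => a s * F (s - r) := by
  have hm := hF.meas
  have := ha.bdd_mul (f := fun s => F (s - r)) (c := H)
    (by fun_prop : Measurable fun s => F (s - r)).aestronglyMeasurable
    (ae_of_all _ fun s => by rw [Real.norm_of_nonneg (hF.nonneg _)]; exact hF.le _)
  exact this.congr (ae_of_all _ fun s => mul_comm _ _)

namespace FiniteProfile

variable {H N : ℝ} {F : ℝ → ℝ}

lemma integrable (hF : FiniteProfile H N F) : Integrable F := by
  simpa using hF.int 0 (by norm_num)

lemma integrable_mul (hF : FiniteProfile H N F) {w : ℝ → ℝ} (hw : Measurable w) {C : ℝ}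
    (hC : ∀ s, 0 < s → |w s| ≤ C * (1 + s ^ 6)) : Integrable fun s => F s * w s := by
  refine Integrable.mono' ((hF.integrable.add (hF.int 6 le_rfl)).const_mul C)
    (hF.meas.mul hw).aestronglyMeasurable (ae_of_all _ fun s => ?_)
  rcases le_or_gt s 0 with hs | hs
  · simp [hF.zero s hs]
  · rw [norm_mul, Real.norm_of_nonneg (hF.nonneg s), Real.norm_eq_abs]
    have := mul_le_mul_of_nonneg_left (hC s hs) (hF.nonneg s)
    simp only [Pi.add_apply]
    linarith

lemma bound_nonneg (hF : FiniteProfile H N F) : 0 ≤ H ∧ 0 ≤ N :=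
  ⟨(hF.nonneg 0).trans (hF.le 0), (mom_nonneg hF.toProfile 0).trans (hF.mom_le 0 (by norm_num))⟩

lemma integrable_lossKer (hF : FiniteProfile H N F) {r : ℝ} (hr : 0 ≤ r) :
    Integrable fun s => F s * lossKer r s := by
  refine hF.integrable_mul (C := r ^ 2 + 1)
    (measurable_lossKer.comp (measurable_const.prodMk measurable_id)) fun s hs => ?_
  rw [abs_of_nonneg (lossKer_nonneg hr hs.le)]
  refine (lossKer_le r s).trans ?_
  have h2 : s ^ 2 ≤ 1 + s ^ 6 := by
    rcases le_total 1 s with h | h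
    · have := pow_le_pow_right₀ h (show 2 ≤ 6 by norm_num); linarith
    · have := pow_le_one₀ (n := 2) hs.le h
      have : 0 ≤ s ^ 6 := by positivity
      linarith
  have h3 : 0 ≤ r ^ 2 * s ^ 6 := by positivity
  nlinarith

lemma integrable_spread (hF : FiniteProfile H N F) {r : ℝ} (hr : 0 ≤ r) :
    Integrable fun s => F s * spread r s := by
  refine hF.integrable_mul (C := 1)
    (measurable_spread.comp (measurable_const.prodMk measurable_id)) fun s hs => ?_
  rw [abs_of_nonneg (spread_nonneg r s), one_mul]
  refine (spread_le hr).trans ?_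
  rcases le_total 1 s with h | h
  · have := pow_le_pow_right₀ h (show 2 ≤ 6 by norm_num); linarith
  · have := pow_le_one₀ (n := 2) hs.le h
    have : 0 ≤ s ^ 6 := by positivity
    linarith

lemma integral_lossKer_le (hF : FiniteProfile H N F) (r : ℝ) (hr : 0 ≤ r) :
    ∫ s, F s * lossKer r s ≤ r ^ 2 * mom F 0 + mom F 2 := by
  have i0 := hF.int 0 (by norm_num)
  have i2 := hF.int 2 (by norm_num)
  unfold mom
  rw [← integral_const_mul, ← integral_add (i0.const_mul _) i2]
  refine integral_mono (hF.integrable_lossKer hr) ((i0.const_mul _).add i2) fun s => ?_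
  have := mul_le_mul_of_nonneg_left (lossKer_le r s) (hF.nonneg s)
  simp only [pow_zero, mul_one]
  linarith

lemma integral_lossKer_nonneg (hF : Profile H F) {r : ℝ} (hr : 0 ≤ r) :
    0 ≤ ∫ s, F s * lossKer r s := by
  refine integral_nonneg fun s => ?_
  rcases le_or_gt s 0 with hs | hs
  · simp [hF.zero s hs]
  · exact mul_nonneg (hF.nonneg s) (lossKer_nonneg hr hs.le)

lemma lossRate_le (hF : FiniteProfile H N F) {r R : ℝ} (hr : 0 ≤ r) (hrR : r ≤ R) (hR : 1 ≤ R) :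
    lossRate F r ≤ (8 * N + 1) * R ^ 5 := by
  have h := hF.integral_lossKer_le r hr
  have hN := hF.bound_nonneg.2
  have h0 := hF.mom_le 0 (by norm_num)
  have h2 := hF.mom_le 2 (by norm_num)
  have a1 : r ^ 2 * mom F 0 ≤ R ^ 2 * N := mul_le_mul (pow_le_pow_left₀ hr hrR 2) h0
    (mom_nonneg hF.toProfile 0) (by positivity)
  have a2 : R ^ 2 ≤ R ^ 5 := pow_le_pow_right₀ hR (by norm_num)
  have a3 : 1 ≤ R ^ 5 := one_le_pow₀ hR
  have a4 : r ^ 5 ≤ R ^ 5 := pow_le_pow_left₀ hr hrR 5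
  have a5 := mul_le_mul_of_nonneg_right a2 hN
  have a6 := mul_le_mul_of_nonneg_right a3 hN
  unfold lossRate
  linarith

lemma gainOp_le (hF : FiniteProfile H N F) (r : ℝ) : gainOp F r ≤ (6 * H + 2) * N := by
  obtain ⟨hH, hN⟩ := hF.bound_nonneg
  unfold gainOp
  split_ifs with hr
  swap
  · positivity
  have i2 := hF.int 2 (by norm_num)
  have i4 := hF.int 4 (by norm_num)
  have m2 := hF.mom_le 2 (by norm_num)
  have m4 := hF.mom_le 4 (by norm_num)
  have b1 : r ^ 2 * conv F F r ≤ 4 * H * mom F 2 := by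
    have i2' : Integrable fun s => F (r - s) * (r - s) ^ 2 := i2.comp_sub_left r
    have e : 4 * H * mom F 2 =
        ∫ s, (2 * H) * (F s * s ^ 2 + F (r - s) * (r - s) ^ 2) := by
      rw [integral_const_mul, integral_add i2 i2',
        integral_sub_left_eq_self (fun s => F s * s ^ 2) volume r]
      unfold mom; ring
    rw [e]
    unfold conv
    rw [← integral_const_mul]
    refine integral_mono_of_nonneg (ae_of_all _ fun s => ?_) ((i2.add i2').const_mul _)
      (ae_of_all _ fun s => ?_)
    · exact mul_nonneg (sq_nonneg r) (mul_nonneg (hF.nonneg _) (hF.nonneg _))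
    · dsimp only
      have hsq : r ^ 2 ≤ 2 * (s ^ 2 + (r - s) ^ 2) := by nlinarith [sq_nonneg (r - 2 * s)]
      have c1 := hF.nonneg s
      have c2 := hF.nonneg (r - s)
      have d1 : F s * F (r - s) * s ^ 2 ≤ H * (F s * s ^ 2) := by
        have := mul_le_mul_of_nonneg_left (hF.le (r - s)) (mul_nonneg c1 (sq_nonneg s))
        linarith
      have d2 : F s * F (r - s) * (r - s) ^ 2 ≤ H * (F (r - s) * (r - s) ^ 2) := by
        have := mul_le_mul_of_nonneg_right (hF.le s) (mul_nonneg c2 (sq_nonneg (r - s)))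
        linarith
      have := mul_le_mul_of_nonneg_right hsq (mul_nonneg c1 c2)
      linarith
  have b2 : r ^ 2 * corr F F r ≤ H * mom F 2 := by
    unfold corr mom
    rw [← integral_const_mul, ← integral_const_mul]
    refine integral_mono_of_nonneg (ae_of_all _ fun s => ?_) (i2.const_mul _)
      (ae_of_all _ fun s => ?_)
    · exact mul_nonneg (sq_nonneg r) (mul_nonneg (hF.nonneg _) (hF.nonneg _))
    · dsimp only
      have c1 := hF.nonneg s
      rcases le_or_gt s r with h | h
      · rw [hF.zero (s - r) (by linarith)]
        simp only [mul_zero]; positivity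
      · have hsq : r ^ 2 ≤ s ^ 2 := by gcongr
        have := mul_le_mul hsq (hF.le (s - r)) (hF.nonneg _) (sq_nonneg s)
        have := mul_le_mul_of_nonneg_left this c1
        linarith
  have b3 : r ^ 2 * ∫ s, F s * spread r s ≤ mom F 4 := by
    unfold mom
    rw [← integral_const_mul]
    refine integral_mono_of_nonneg (ae_of_all _ fun s => ?_) i4 (ae_of_all _ fun s => ?_)
    · exact mul_nonneg (sq_nonneg r) (mul_nonneg (hF.nonneg _) (spread_nonneg _ _))
    · dsimp only
      unfold spread
      split_ifs with h
      · have : (r * (s - r)) ^ 2 ≤ (s * s) ^ 2 := by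
          have : 0 ≤ s - r := by linarith
          gcongr <;> linarith
        have := mul_le_mul_of_nonneg_left this (hF.nonneg s)
        linarith
      · simp only [mul_zero]
        exact mul_nonneg (hF.nonneg s) (by positivity)
  have e1 := mul_le_mul_of_nonneg_left m2 hH
  linarith

/-- At points where the density is at least half of the admissible bound, losses dominate. -/
lemma coll_nonpos (hF : FiniteProfile H N F) {r E K : ℝ} (hr : 0 < r) (hFr : H / 2 ≤ F r)
    (hE : E / 2 ≤ mom F 1) (hK : mom F 2 ≤ K) (h1 : 4 * K ≤ H * E) (h2 : 120 * K ≤ H) :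
    coll F r ≤ 0 := by
  obtain ⟨hH, hN⟩ := hF.bound_nonneg
  have i0 := hF.integrable
  have i1 := hF.int 1 (by norm_num)
  have i2 := hF.int 2 (by norm_num)
  have hq : r ^ 2 * (conv F F r + 2 * corr F F r) + H * r * mom F 1 ≤
      2 * H * ∫ s, F s * lossKer r s := by
    unfold conv corr mom
    have ja := hF.integrable_mul_sub_left i0 r
    have jb := (hF.integrable_mul_sub_right i0 r).const_mul 2
    have jab : Integrable fun s => F s * F (r - s) + 2 * (F s * F (s - r)) := ja.add jb
    rw [← integral_const_mul 2, ← integral_add ja jb, ← integral_const_mul, ← integral_const_mul,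
      ← integral_const_mul, ← integral_add (jab.const_mul _) (i1.const_mul _)]
    refine integral_mono ((jab.const_mul _).add (i1.const_mul _))
      ((hF.integrable_lossKer hr.le).const_mul _) fun s => ?_
    dsimp only
    rcases le_or_gt s 0 with hs | hs
    · simp [hF.zero s hs]
    have c := hF.nonneg s
    have hHF : 0 ≤ H * F s := mul_nonneg hH c
    unfold lossKer
    split_ifs with h
    · rw [hF.zero (r - s) (by linarith)]
      have d1 := mul_le_mul_of_nonneg_left (hF.le (s - r))
        (show 0 ≤ 2 * r ^ 2 * F s by positivity)
      have d2 := mul_le_mul_of_nonneg_left (show 2 * r ^ 2 + r * s ≤ 4 * r * s by nlinarith) hHF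
      linarith
    · rw [hF.zero (s - r) (by linarith)]
      have d1 := mul_le_mul_of_nonneg_left (hF.le (r - s)) (show 0 ≤ r ^ 2 * F s by positivity)
      have d2 := mul_le_mul_of_nonneg_left
        (show r ^ 2 + r * s ≤ 2 * (r ^ 2 + s ^ 2) by nlinarith [sq_nonneg (r - s)]) hHF
      linarith
  have hl : r ^ 2 * ∫ s, F s * spread r s ≤ r ^ 2 * K := by
    refine mul_le_mul_of_nonneg_left (le_trans ?_ hK) (sq_nonneg r)
    exact integral_mono (hF.integrable_spread hr.le) i2 fun s =>
      mul_le_mul_of_nonneg_left (spread_le hr.le) (hF.nonneg s)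
  have hk0 := integral_lossKer_nonneg hF.toProfile hr.le
  have hK0 : 0 ≤ K := (mom_nonneg hF.toProfile 2).trans hK
  have hloss : H / 2 * lossRate F r ≤ F r * lossRate F r := by
    refine mul_le_mul_of_nonneg_right hFr ?_
    unfold lossRate
    positivity
  have hr2 : r ^ 2 ≤ r + r ^ 5 := by
    rcases le_total 1 r with h | h
    · have := pow_le_pow_right₀ h (show 2 ≤ 5 by norm_num); linarith
    · have : 0 ≤ r ^ 5 := by positivity
      nlinarith
  have e1 := mul_le_mul_of_nonneg_left hE (mul_nonneg hH hr.le)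
  have e2 := mul_le_mul_of_nonneg_left hr2 (show 0 ≤ 2 * K by positivity)
  have e3 := mul_le_mul_of_nonneg_left h1 hr.le
  have e4 := mul_le_mul_of_nonneg_left h2 (show 0 ≤ r ^ 5 by positivity)
  unfold coll gainOp
  rw [if_pos hr]
  have : H / 2 * lossRate F r = 2 * H * (∫ s, F s * lossKer r s) + H * r ^ 5 / 60 := by
    unfold lossRate; ring
  linarith

end FiniteProfile

/-! ### Continuity of the collision operator under truncation -/

lemma conv_nonneg {a b : ℝ → ℝ} (ha : ∀ s, 0 ≤ a s) (hb : ∀ s, 0 ≤ b s) (r : ℝ) :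
    0 ≤ conv a b r :=
  integral_nonneg fun s => mul_nonneg (ha s) (hb _)

lemma corr_nonneg {a b : ℝ → ℝ} (ha : ∀ s, 0 ≤ a s) (hb : ∀ s, 0 ≤ b s) (r : ℝ) :
    0 ≤ corr a b r :=
  integral_nonneg fun s => mul_nonneg (ha s) (hb _)

namespace FiniteProfile

variable {H N : ℝ} {F : ℝ → ℝ}

lemma of_le (hF : FiniteProfile H N F) {G : ℝ → ℝ} (hm : Measurable G) (h0 : ∀ s, 0 ≤ G s)
    (h1 : ∀ s, G s ≤ F s) : FiniteProfile H N G := by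
  have hz : ∀ r, r ≤ 0 → G r = 0 := fun r hr => le_antisymm ((h1 r).trans (hF.zero r hr).le) (h0 r)
  have hi : ∀ n ≤ 6, Integrable fun s => G s * s ^ n := by
    intro n hn
    refine (hF.int n hn).mono (by fun_prop) (ae_of_all _ fun s => ?_)
    rw [norm_mul, norm_mul, Real.norm_of_nonneg (h0 s), Real.norm_of_nonneg (hF.nonneg s)]
    exact mul_le_mul_of_nonneg_right (h1 s) (norm_nonneg _)
  refine ⟨⟨hm, h0, fun r => (h1 r).trans (hF.le r), hz⟩, hi, fun n hn =>
    le_trans (integral_mono (hi n hn) (hF.int n hn) fun s => ?_) (hF.mom_le n hn)⟩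
  dsimp only
  rcases le_or_gt s 0 with hs | hs
  · simp [hF.zero s hs, hz s hs]
  · exact mul_le_mul_of_nonneg_right (h1 s) (by positivity)

lemma integrable_conv_mul_sq {a b : ℝ → ℝ} (ha : Profile H a)
    (hb : FiniteProfile H N b) (r : ℝ) :
    Integrable fun s => a s * (b (r - s) * (r - s) ^ 2) := by
  have hm := ha.meas
  exact ((hb.int 2 (by norm_num)).comp_sub_left r).bdd_mul (c := H) hm.aestronglyMeasurable
    (ae_of_all _ fun s => by rw [Real.norm_of_nonneg (ha.nonneg _)]; exact ha.le _)

lemma sq_mul_conv_le {a b : ℝ → ℝ} (ha : FiniteProfile H N a) (hb : FiniteProfile H N b) (r : ℝ) :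
    r ^ 2 * conv a b r ≤
      2 * (conv (fun s => a s * s ^ 2) b r + conv a (fun s => b s * s ^ 2) r) := by
  have i1 := hb.integrable_mul_sub_left (ha.int 2 (by norm_num)) r
  have i2 := integrable_conv_mul_sq ha.toProfile hb r
  unfold conv
  rw [← integral_add i1 i2, ← integral_const_mul, ← integral_const_mul]
  refine integral_mono ((hb.integrable_mul_sub_left ha.integrable r).const_mul _)
    ((i1.add i2).const_mul 2) fun s => ?_
  dsimp only
  have hsq : r ^ 2 ≤ 2 * (s ^ 2 + (r - s) ^ 2) := by nlinarith [sq_nonneg (r - 2 * s)]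
  have := mul_le_mul_of_nonneg_right hsq (mul_nonneg (ha.nonneg s) (hb.nonneg (r - s)))
  linarith

lemma sq_mul_corr_le {a b : ℝ → ℝ} (ha : FiniteProfile H N a) (hb : FiniteProfile H N b) {r : ℝ}
    (hr : 0 < r) : r ^ 2 * corr a b r ≤ corr (fun s => a s * s ^ 2) b r := by
  have i1 := hb.integrable_mul_sub_right (ha.int 2 (by norm_num)) r
  unfold corr
  rw [← integral_const_mul]
  refine integral_mono ((hb.integrable_mul_sub_right ha.integrable r).const_mul _) i1 fun s => ?_
  dsimp only
  rcases le_or_gt s r with h | h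
  · rw [hb.zero (s - r) (by linarith)]
    simp
  · have hsq : r ^ 2 ≤ s ^ 2 := by gcongr
    have := mul_le_mul_of_nonneg_right hsq (mul_nonneg (ha.nonneg s) (hb.nonneg (s - r)))
    linarith

/-- The pointwise dominator of a difference of collision terms. -/
noncomputable def diffBound (F D : ℝ → ℝ) (r : ℝ) : ℝ :=
  2 * (conv (fun s => D s * s ^ 2) F r + conv D (fun s => F s * s ^ 2) r) +
  2 * (conv (fun s => F s * s ^ 2) D r + conv F (fun s => D s * s ^ 2) r) +
  2 * (corr (fun s => D s * s ^ 2) F r + corr (fun s => F s * s ^ 2) D r) +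
  2 * (if 0 < r then r ^ 2 * ∫ s, D s * spread r s else 0) +
  (4 * (mom F 0 * (D r * r ^ 2) + mom F 2 * D r) + D r * r ^ 5 / 30) +
  4 * (mom D 0 * (F r * r ^ 2) + mom D 2 * F r)

lemma diffBound_nonneg {D : ℝ → ℝ} (hF : Profile H F) (hD : Profile H D) (r : ℝ) :
    0 ≤ diffBound F D r := by
  have f := hF.nonneg
  have d := hD.nonneg
  have f2 : ∀ s, 0 ≤ F s * s ^ 2 := fun s => mul_nonneg (f s) (sq_nonneg s)
  have d2 : ∀ s, 0 ≤ D s * s ^ 2 := fun s => mul_nonneg (d s) (sq_nonneg s)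
  have c1 := conv_nonneg d2 f r
  have c2 := conv_nonneg d f2 r
  have c3 := conv_nonneg f2 d r
  have c4 := conv_nonneg f d2 r
  have c5 := corr_nonneg d2 f r
  have c6 := corr_nonneg f2 d r
  have s1 : 0 ≤ ∫ s, D s * spread r s :=
    integral_nonneg fun s => mul_nonneg (d s) (spread_nonneg _ _)
  have s2 : 0 ≤ if 0 < r then r ^ 2 * ∫ s, D s * spread r s else 0 := by
    split_ifs
    · positivity
    · exact le_rfl
  have s3 : 0 ≤ D r * r ^ 5 := by
    rcases le_or_gt r 0 with hr | hr
    · simp [hD.zero r hr]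
    · exact mul_nonneg (d r) (by positivity)
  have t1 := mul_nonneg (mom_nonneg hF 0) (d2 r)
  have t2 := mul_nonneg (mom_nonneg hF 2) (d r)
  have t3 := mul_nonneg (mom_nonneg hD 0) (f2 r)
  have t4 := mul_nonneg (mom_nonneg hD 2) (f r)
  unfold diffBound
  positivity

lemma integral_diffBound_le {D : ℝ → ℝ} (hF : FiniteProfile H N F) (hD : FiniteProfile H N D)
    {μ : ℝ} (hμ : ∀ n ≤ 5, mom D n ≤ μ) :
    Integrable (diffBound F D) ∧ ∫ r, diffBound F D r ≤ (28 * N + 2) * μ := by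
  have f0 := hF.integrable
  have f2 := hF.int 2 (by norm_num)
  have d0 := hD.integrable
  have d2 := hD.int 2 (by norm_num)
  have d5 := hD.int 5 (by norm_num)
  obtain ⟨a1, b1⟩ := conv_integral d2 f0
  obtain ⟨a2, b2⟩ := conv_integral d0 f2
  obtain ⟨a3, b3⟩ := conv_integral f2 d0
  obtain ⟨a4, b4⟩ := conv_integral f0 d2
  obtain ⟨a5, b5⟩ := corr_integral d2 f0
  obtain ⟨a6, b6⟩ := corr_integral f2 d0
  obtain ⟨a7, b7⟩ := hD.spread_moment 2 d5
  have A1 := (a1.add a2).const_mul 2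
  have A2 := (a3.add a4).const_mul 2
  have A3 := (a5.add a6).const_mul 2
  have A4 := a7.const_mul 2
  have A5 := (((d2.const_mul (mom F 0)).add (d0.const_mul (mom F 2))).const_mul 4).add
    (d5.div_const 30)
  have A6 := ((f2.const_mul (mom D 0)).add (f0.const_mul (mom D 2))).const_mul 4
  have e : ∫ r, diffBound F D r = 14 * (mom D 2 * mom F 0 + mom D 0 * mom F 2) + mom D 5 / 10 := by
    have h := integral_add' ((((A1.add A2).add A3).add A4).add A5) A6
    rw [integral_add' (((A1.add A2).add A3).add A4) A5, integral_add' ((A1.add A2).add A3) A4,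
      integral_add' (A1.add A2) A3, integral_add' A1 A2, integral_const_mul, integral_const_mul,
      integral_const_mul, integral_const_mul, integral_const_mul, integral_add' a1 a2,
      integral_add' a3 a4, integral_add' a5 a6, integral_add'
        (((d2.const_mul (mom F 0)).add (d0.const_mul (mom F 2))).const_mul 4) (d5.div_const 30),
      integral_const_mul, integral_add' (d2.const_mul (mom F 0)) (d0.const_mul (mom F 2)),
      integral_add' (f2.const_mul (mom D 0)) (f0.const_mul (mom D 2)), integral_const_mul,
      integral_const_mul, integral_const_mul, integral_const_mul, integral_div, b1, b2, b3, b4, b5,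
      b6, b7] at h
    refine h.trans ?_
    simp only [mom, pow_zero, mul_one]
    push_cast
    ring
  have nF0 := mom_nonneg hF.toProfile 0
  have nF2 := mom_nonneg hF.toProfile 2
  have nD0 := mom_nonneg hD.toProfile 0
  have lF0 := hF.mom_le 0 (by norm_num)
  have lF2 := hF.mom_le 2 (by norm_num)
  have lD0 := hμ 0 (by norm_num)
  have lD2 := hμ 2 (by norm_num)
  have lD5 := hμ 5 (by norm_num)
  refine ⟨((((A1.add A2).add A3).add A4).add A5).add A6, ?_⟩
  rw [e]
  have c1 : mom D 2 * mom F 0 ≤ μ * N := mul_le_mul lD2 lF0 nF0 (nD0.trans lD0)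
  have c2 : mom D 0 * mom F 2 ≤ μ * N := mul_le_mul lD0 lF2 nF2 (nD0.trans lD0)
  linarith

lemma abs_coll_sub_le {G D : ℝ → ℝ} (hF : FiniteProfile H N F) (hG : FiniteProfile H N G)
    (hD : FiniteProfile H N D) (hFG : ∀ s, F s = G s + D s) (r : ℝ) :
    |coll F r - coll G r| ≤ diffBound F D r := by
  rcases le_or_gt r 0 with hr | hr
  · have : coll F r - coll G r = 0 := by
      simp [coll, gainOp, not_lt.2 hr, hF.zero r hr, hG.zero r hr]
    rw [this, abs_zero]
    exact diffBound_nonneg hF.toProfile hD.toProfile r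
  have hGF : ∀ s, G s ≤ F s := fun s => by have := hD.nonneg s; linarith [hFG s]
  have hconv : conv G G r ≤ conv F F r ∧ conv F F r - conv G G r ≤ conv D F r + conv F D r := by
    have g := hG.integrable_mul_sub_left hG.integrable r
    have f := hF.integrable_mul_sub_left hF.integrable r
    have df := hF.integrable_mul_sub_left hD.integrable r
    have fd := hD.integrable_mul_sub_left hF.integrable r
    unfold conv
    refine ⟨integral_mono g f fun s => mul_le_mul (hGF _) (hGF _) (hG.nonneg _) (hF.nonneg _), ?_⟩
    rw [← integral_sub f g, ← integral_add df fd]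
    refine integral_mono (f.sub g) (df.add fd) fun s => ?_
    have := mul_nonneg (hD.nonneg s) (hD.nonneg (r - s))
    simp only [hFG s, hFG (r - s)]
    nlinarith
  have hcorr : corr G G r ≤ corr F F r ∧ corr F F r - corr G G r ≤ corr D F r + corr F D r := by
    have g := hG.integrable_mul_sub_right hG.integrable r
    have f := hF.integrable_mul_sub_right hF.integrable r
    have df := hF.integrable_mul_sub_right hD.integrable r
    have fd := hD.integrable_mul_sub_right hF.integrable r
    unfold corr
    refine ⟨integral_mono g f fun s => mul_le_mul (hGF _) (hGF _) (hG.nonneg _) (hF.nonneg _), ?_⟩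
    rw [← integral_sub f g, ← integral_add df fd]
    refine integral_mono (f.sub g) (df.add fd) fun s => ?_
    have := mul_nonneg (hD.nonneg s) (hD.nonneg (s - r))
    simp only [hFG s, hFG (s - r)]
    nlinarith
  have hspread : ∫ s, F s * spread r s = (∫ s, G s * spread r s) + ∫ s, D s * spread r s := by
    rw [← integral_add (hG.integrable_spread hr.le) (hD.integrable_spread hr.le)]
    congr 1; ext s
    rw [hFG]; ring
  have hloss : ∫ s, F s * lossKer r s = (∫ s, G s * lossKer r s) + ∫ s, D s * lossKer r s := by
    rw [← integral_add (hG.integrable_lossKer hr.le) (hD.integrable_lossKer hr.le)]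
    congr 1; ext s
    rw [hFG]; ring
  have nsp : 0 ≤ ∫ s, D s * spread r s :=
    integral_nonneg fun s => mul_nonneg (hD.nonneg s) (spread_nonneg _ _)
  have nF := integral_lossKer_nonneg hF.toProfile hr.le
  have nD := integral_lossKer_nonneg hD.toProfile hr.le
  have lF := hF.integral_lossKer_le r hr.le
  have lD := hD.integral_lossKer_le r hr.le
  have q1 := sq_mul_conv_le hD hF r
  have q2 := sq_mul_conv_le hF hD r
  have q3 := sq_mul_corr_le hD hF hr
  have q4 := sq_mul_corr_le hF hD hr
  have r2 := sq_nonneg r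
  have t1 := mul_le_mul_of_nonneg_left hconv.1 r2
  have t2 := mul_le_mul_of_nonneg_left hconv.2 r2
  have t3 := mul_le_mul_of_nonneg_left hcorr.1 r2
  have t4 := mul_le_mul_of_nonneg_left hcorr.2 r2
  have t5 : 0 ≤ r ^ 2 * ∫ s, D s * spread r s := mul_nonneg r2 nsp
  have s1 := mul_le_mul_of_nonneg_left lF (hD.nonneg r)
  have s2 := mul_le_mul (hGF r) lD nD (hF.nonneg r)
  have s3 := mul_nonneg (hD.nonneg r) nF
  have s4 := mul_nonneg (hG.nonneg r) nD
  have s5 : 0 ≤ D r * r ^ 5 := mul_nonneg (hD.nonneg r) (by positivity)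
  have key : F r * lossRate F r - G r * lossRate G r =
      4 * (D r * ∫ s, F s * lossKer r s) + D r * r ^ 5 / 30 +
        4 * (G r * ∫ s, D s * lossKer r s) := by
    unfold lossRate
    rw [hloss, hFG r]; ring
  have key2 : gainOp F r - gainOp G r = r ^ 2 * (conv F F r - conv G G r) +
      2 * (r ^ 2 * (corr F F r - corr G G r)) + 2 * (r ^ 2 * ∫ s, D s * spread r s) := by
    unfold gainOp
    rw [if_pos hr, if_pos hr, hspread]; ring
  have n1 := corr_nonneg (fun s => mul_nonneg (hD.nonneg s) (sq_nonneg s)) hF.nonneg r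
  have n2 := corr_nonneg (fun s => mul_nonneg (hF.nonneg s) (sq_nonneg s)) hD.nonneg r
  have p1 := conv_nonneg hD.nonneg hF.nonneg r
  have p2 := conv_nonneg hF.nonneg hD.nonneg r
  have p3 := mul_nonneg r2 p1
  have p4 := mul_nonneg r2 p2
  unfold diffBound
  rw [if_pos hr]
  unfold coll
  rw [abs_le]
  constructor <;> linarith

lemma integral_abs_coll_sub_le {G D : ℝ → ℝ} (hF : FiniteProfile H N F)
    (hG : FiniteProfile H N G) (hD : FiniteProfile H N D) (hFG : ∀ s, F s = G s + D s)
    {μ : ℝ} (hμ : ∀ n ≤ 5, mom D n ≤ μ) :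
    Integrable (fun r => coll F r - coll G r) ∧
      ∫ r, |coll F r - coll G r| ≤ (28 * N + 2) * μ := by
  obtain ⟨h1, h2⟩ := integral_diffBound_le hF hD hμ
  have hm : Measurable fun r => coll F r - coll G r := hF.measurable_coll.sub hG.measurable_coll
  have hp := abs_coll_sub_le hF hG hD hFG
  have hi : Integrable (fun r => coll F r - coll G r) :=
    h1.mono' hm.aestronglyMeasurable (ae_of_all _ hp)
  exact ⟨hi, (integral_mono hi.abs h1 hp).trans h2⟩

end FiniteProfile

/-! ### From radial profiles to densities -/

/-- The capped density `min (f r * r ^ 2) H` of a radial profile, extended by zero. -/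
noncomputable def density (H : ℝ) (f : ℝ → ℝ) (s : ℝ) : ℝ :=
  if 0 < s then min (f s * s ^ 2) H else 0

section Density

variable {H : ℝ} {f : ℝ → ℝ}

lemma density_profile (hH : 0 ≤ H) (hm : Measurable f) (h0 : ∀ r, 0 ≤ f r) :
    Profile H (density H f) := by
  unfold density
  refine ⟨Measurable.ite measurableSet_Ioi (by fun_prop) (by fun_prop), fun r => ?_, fun r => ?_,
    fun r hr => if_neg (not_lt.2 hr)⟩
  · split_ifs
    · exact le_min (mul_nonneg (h0 r) (sq_nonneg r)) hH
    · exact le_rfl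
  · split_ifs
    · exact min_le_right _ _
    · exact hH

lemma density_ae (hle : ∀ᵐ r ∂(volume.restrict (Ioi (0 : ℝ))), f r * r ^ 2 ≤ H) :
    ∀ᵐ s, 0 < s → density H f s = f s * s ^ 2 := by
  filter_upwards [(ae_restrict_iff' measurableSet_Ioi).1 hle] with s hs h
  rw [density, if_pos h, min_eq_left (hs h)]

lemma density_mom (hle : ∀ᵐ r ∂(volume.restrict (Ioi (0 : ℝ))), f r * r ^ 2 ≤ H) (n : ℕ)
    {k : ℝ} (hk : k = n + 2) (hi : IntegrableOn (fun r => f r * r ^ k) (Ioi (0 : ℝ))) :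
    Integrable (fun s => density H f s * s ^ n) ∧ mom (density H f) n = lm f k := by
  have e : (fun s => density H f s * s ^ n) =ᵐ[volume]
      (Ioi (0 : ℝ)).indicator fun r => f r * r ^ k := by
    filter_upwards [density_ae hle] with s hs
    by_cases h : 0 < s
    · rw [hs h, indicator_of_mem (mem_Ioi.2 h), hk]
      rw [show (n : ℝ) + 2 = ((n + 2 : ℕ) : ℝ) by push_cast; rfl, rpow_natCast]
      ring
    · rw [indicator_of_notMem (by simpa using h), density, if_neg h, zero_mul]
  rw [← integrable_indicator_iff measurableSet_Ioi] at hi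
  refine ⟨hi.congr e.symm, ?_⟩
  rw [mom, integral_congr_ae e, integral_indicator measurableSet_Ioi, lm]

lemma Profile.finiteProfile {F : ℝ → ℝ} (hF : Profile H F) {E K : ℝ}
    (i1 : Integrable fun s => F s * s ^ 1) (i6 : Integrable fun s => F s * s ^ 6)
    (m1 : mom F 1 ≤ E) (m6 : mom F 6 ≤ K) :
    FiniteProfile H (H + E + K) F ∧ mom F 0 ≤ H + E ∧ mom F 2 ≤ E + K := by
  have hm := hF.meas
  have hH : 0 ≤ H := (hF.nonneg 0).trans (hF.le 0)
  have n1 := mom_nonneg hF 1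
  have n6 := mom_nonneg hF 6
  have key : ∀ n, 1 ≤ n → n ≤ 6 → Integrable (fun s => F s * s ^ n) ∧ mom F n ≤ E + K := by
    intro n h1 h6
    have hb : ∀ s, 0 ≤ F s * s ^ n ∧ F s * s ^ n ≤ F s * s ^ 1 + F s * s ^ 6 := by
      intro s
      rcases le_or_gt s 0 with hs | hs
      · simp [hF.zero s hs]
      have hp : s ^ n ≤ s ^ 1 + s ^ 6 := by
        rcases le_total 1 s with h | h
        · have := pow_le_pow_right₀ h h6
          have : 0 ≤ s ^ 1 := by positivity
          linarith
        · have := pow_le_pow_of_le_one hs.le h h1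
          have : 0 ≤ s ^ 6 := by positivity
          linarith
      have := mul_le_mul_of_nonneg_left hp (hF.nonneg s)
      exact ⟨mul_nonneg (hF.nonneg s) (by positivity), by linarith⟩
    have hi : Integrable fun s => F s * s ^ n := by
      refine (i1.add i6).mono' (by fun_prop) (ae_of_all _ fun s => ?_)
      rw [Real.norm_of_nonneg (hb s).1]
      exact (hb s).2
    refine ⟨hi, (integral_mono hi (i1.add i6) fun s => (hb s).2).trans ?_⟩
    rw [integral_add' i1 i6]
    exact add_le_add m1 m6
  have key0 : Integrable F ∧ mom F 0 ≤ H + E := by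
    have iu : Integrable ((Ioc (0 : ℝ) 1).indicator fun _ => H) :=
      (integrable_indicator_iff measurableSet_Ioc).2 (by simp)
    have hb : ∀ s, F s ≤ (Ioc (0 : ℝ) 1).indicator (fun _ => H) s + F s * s ^ 1 := by
      intro s
      have hn := hF.nonneg s
      rcases le_or_gt s 0 with hs | hs
      · simp [hF.zero s hs, hs]
      rcases le_or_gt s 1 with h | h
      · rw [indicator_of_mem (mem_Ioc.2 ⟨hs, h⟩)]
        have := hF.le s
        have : 0 ≤ F s * s ^ 1 := by positivity
        linarith
      · rw [indicator_of_notMem (fun h' => absurd h'.2 (not_le.2 h))]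
        nlinarith
    have hi : Integrable F := by
      refine (iu.add i1).mono' (by fun_prop) (ae_of_all _ fun s => ?_)
      rw [Real.norm_of_nonneg (hF.nonneg s)]
      exact hb s
    refine ⟨hi, ?_⟩
    have h := integral_mono hi (iu.add i1) hb
    rw [integral_add' iu i1, integral_indicator measurableSet_Ioc] at h
    simp only [integral_const, MeasurableSet.univ, measureReal_restrict_apply, univ_inter,
      Real.volume_real_Ioc, smul_eq_mul] at h
    norm_num at h
    simp only [mom, pow_zero, mul_one, pow_one] at m1 ⊢
    linarith
  refine ⟨⟨hF, fun n hn => ?_, fun n hn => ?_⟩, key0.2, (key 2 (by norm_num) (by norm_num)).2⟩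
  · rcases Nat.eq_zero_or_pos n with rfl | h
    · simpa using key0.1
    · exact (key n h hn).1
  · rcases Nat.eq_zero_or_pos n with rfl | h
    · linarith [key0.2]
    · linarith [(key n h hn).2]

lemma integral_Kker {r : ℝ} : ∫ s in (0 : ℝ)..r, Kker s (r - s) = r ^ 7 / 30 := by
  have e : (fun s => Kker s (r - s)) = fun s =>
      r ^ 4 * s ^ 2 - 2 * r ^ 3 * s ^ 3 + r ^ 2 * s ^ 4 := by
    ext s; unfold Kker; ring
  rw [e, intervalIntegral.integral_add, intervalIntegral.integral_sub,
    intervalIntegral.integral_const_mul, intervalIntegral.integral_const_mul,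
    intervalIntegral.integral_const_mul, integral_pow, integral_pow, integral_pow]
  · norm_num; ring
  all_goals apply Continuous.intervalIntegrable; fun_prop

lemma Qcol_eq {N : ℝ} (hF : FiniteProfile H N (density H f))
    (hle : ∀ᵐ r ∂(volume.restrict (Ioi (0 : ℝ))), f r * r ^ 2 ≤ H) {r : ℝ} (hr : 0 < r)
    (hfr : density H f r = f r * r ^ 2) :
    Qcol f r = 8 * π ^ 2 * coll (density H f) r := by
  have hae := density_ae hle
  set F := density H f with hFdef
  have z : ∀ s, ¬ 0 < s → F s = 0 := fun s hs => hF.zero s (not_lt.1 hs)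
  have e1 : ∫ s in (0 : ℝ)..r, Kker s (r - s) * f s * f (r - s) = r ^ 2 * conv F F r := by
    rw [intervalIntegral.integral_of_le hr.le, ← integral_indicator measurableSet_Ioc, conv,
      ← integral_const_mul]
    refine integral_congr_ae ?_
    filter_upwards [hae, (quasiMeasurePreserving_sub_left volume r).ae hae] with s h1 h2
    by_cases hs : s ∈ Ioc 0 r
    · rw [indicator_of_mem hs, h1 hs.1]
      rcases hs.2.lt_or_eq with h | h
      · rw [h2 (by linarith)]; unfold Kker; ring
      · rw [h, z (r - r) (by simp)]; simp [Kker]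
    · rw [indicator_of_notMem hs]
      by_cases h : 0 < s
      · rw [z (r - s) fun h' => hs ⟨h, by linarith⟩]; ring
      · rw [z s h]; ring
  have e2 : ∫ s in Ioi r, Kker r (s - r) * f s * f (s - r) = r ^ 2 * corr F F r := by
    rw [← integral_indicator measurableSet_Ioi, corr, ← integral_const_mul]
    refine integral_congr_ae ?_
    filter_upwards [hae, (measurePreserving_sub_right volume r).quasiMeasurePreserving.ae hae]
      with s h1 h2
    by_cases hs : r < s
    · rw [indicator_of_mem (mem_Ioi.2 hs), h1 (hr.trans hs), h2 (by linarith)]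
      unfold Kker; ring
    · rw [indicator_of_notMem (by simpa using hs), z (s - r) fun h' => hs (by linarith)]; ring
  have e3 : ∫ s in Ioi r, Kker r (s - r) * f s = r ^ 2 * ∫ s, F s * spread r s := by
    rw [← integral_indicator measurableSet_Ioi, ← integral_const_mul]
    refine integral_congr_ae ?_
    filter_upwards [hae] with s h1
    unfold spread
    by_cases hs : r < s
    · rw [indicator_of_mem (mem_Ioi.2 hs), h1 (hr.trans hs), if_pos hs]
      unfold Kker; ring
    · rw [indicator_of_notMem (by simpa using hs), if_neg hs]; ring
  have e4 : ∫ s in (0 : ℝ)..r, Kker s (r - s) * f s =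
      r ^ 2 * ∫ s, F s * ((s - r) ^ 2 - spread r s) := by
    rw [intervalIntegral.integral_of_le hr.le, ← integral_indicator measurableSet_Ioc,
      ← integral_const_mul]
    refine integral_congr_ae ?_
    filter_upwards [hae] with s h1
    unfold spread
    by_cases hs : s ∈ Ioc 0 r
    · rw [indicator_of_mem hs, h1 hs.1, if_neg (not_lt.2 hs.2)]
      unfold Kker; ring
    · rw [indicator_of_notMem hs]
      by_cases h : 0 < s
      · rw [if_pos (not_le.1 fun h' => hs ⟨h, h'⟩)]; ring
      · rw [z s h]; ring
  have e5 : ∫ s in Ioi (0 : ℝ), Kker r s * f s = r ^ 2 * ∫ s, F s * (r + s) ^ 2 := by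
    rw [← integral_indicator measurableSet_Ioi, ← integral_const_mul]
    refine integral_congr_ae ?_
    filter_upwards [hae] with s h1
    by_cases hs : 0 < s
    · rw [indicator_of_mem (mem_Ioi.2 hs), h1 hs]
      unfold Kker; ring
    · rw [indicator_of_notMem (by simpa using hs), z s hs]; ring
  have e6 : (∫ s, F s * spread r s) - (∫ s, F s * ((s - r) ^ 2 - spread r s)) -
      (∫ s, F s * (r + s) ^ 2) = -2 * ∫ s, F s * lossKer r s := by
    have is := hF.integrable_spread hr.le
    have i0 := hF.integrable
    have i1 := hF.int 1 (by norm_num)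
    have i2 := hF.int 2 (by norm_num)
    have k1 : Integrable fun s => F s * ((s - r) ^ 2 - spread r s) := by
      refine (((i2.sub (i1.const_mul (2 * r))).add (i0.const_mul (r ^ 2))).sub is).congr
        (ae_of_all _ fun s => ?_)
      simp only [Pi.add_apply, Pi.sub_apply]; ring
    have k2 : Integrable fun s => F s * (r + s) ^ 2 := by
      refine ((i2.add (i1.const_mul (2 * r))).add (i0.const_mul (r ^ 2))).congr
        (ae_of_all _ fun s => ?_)
      simp only [Pi.add_apply]; ring
    have h1 := integral_sub' (is.sub k1) k2
    rw [integral_sub' is k1] at h1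
    rw [← h1, ← integral_const_mul]
    congr 1; ext s
    simp only [Pi.sub_apply]
    unfold spread lossKer
    split_ifs <;> ring
  unfold Qcol Qq Lop coll gainOp lossRate
  rw [if_pos hr, e1, e2, e3, e4, e5, integral_Kker, hfr]
  linear_combination (8 * π ^ 2 * (2 * f r * r ^ 2)) * e6

end Density

/-! ### Truncated Euler steps -/

/-- The part of a density carried by energies at most `R`. -/
noncomputable def low (R : ℝ) (F : ℝ → ℝ) (s : ℝ) : ℝ := if s ≤ R then F s else 0

/-- The part of a density carried by energies above `R`. -/
noncomputable def high (R : ℝ) (F : ℝ → ℝ) (s : ℝ) : ℝ := if s ≤ R then 0 else F s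

namespace FiniteProfile

variable {H N R : ℝ} {F : ℝ → ℝ}

lemma low_finiteProfile (hF : FiniteProfile H N F) : FiniteProfile H N (low R F) := by
  have hm := hF.meas
  refine hF.of_le ?_ (fun s => ?_) fun s => ?_
  · exact Measurable.ite measurableSet_Iic hm measurable_const
  all_goals unfold low; split_ifs
  exacts [hF.nonneg s, le_rfl, le_rfl, hF.nonneg s]

lemma high_finiteProfile (hF : FiniteProfile H N F) : FiniteProfile H N (high R F) := by
  have hm := hF.meas
  refine hF.of_le ?_ (fun s => ?_) fun s => ?_
  · exact Measurable.ite measurableSet_Iic measurable_const hm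
  all_goals unfold high; split_ifs
  exacts [le_rfl, hF.nonneg s, hF.nonneg s, le_rfl]

lemma low_add_high (R : ℝ) (F : ℝ → ℝ) (s : ℝ) : F s = low R F s + high R F s := by
  unfold low high; split_ifs <;> simp

lemma mom_low_add_high (hF : FiniteProfile H N F) {n : ℕ} (hn : n ≤ 6) :
    mom F n = mom (low R F) n + mom (high R F) n := by
  unfold mom
  rw [← integral_add (hF.low_finiteProfile.int n hn) (hF.high_finiteProfile.int n hn)]
  congr 1; ext s
  rw [low_add_high R F s, add_mul]

lemma mom_high_le (hF : FiniteProfile H N F) (hR : 0 ≤ R) {n : ℕ} (hn : n ≤ 6) :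
    R ^ (6 - n) * mom (high R F) n ≤ mom (high R F) 6 := by
  unfold mom
  rw [← integral_const_mul]
  refine integral_mono ((hF.high_finiteProfile.int n hn).const_mul _)
    (hF.high_finiteProfile.int 6 le_rfl) fun s => ?_
  dsimp only
  unfold high
  split_ifs with h
  · simp
  · have hs : R ≤ s := (not_le.1 h).le
    have hs0 : 0 ≤ s := hR.trans hs
    have : R ^ (6 - n) * s ^ n ≤ s ^ (6 - n) * s ^ n := by gcongr
    rw [← pow_add, Nat.sub_add_cancel hn] at this
    have := mul_le_mul_of_nonneg_left this (hF.nonneg s)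
    linarith

/-- An explicit Euler step for the truncated density stays admissible,
except that it lost the energy of the truncated tail. -/
lemma euler_step (hF : FiniteProfile H N F) {E K τ : ℝ} (hE : 0 < E)
    (hK : 2 * (E + 80 * (504 * (1 + 40320 * E) ^ 6 * E ^ 2)) ≤ K) (hH1 : 4 * (E + K) ≤ H * E)
    (hH2 : 120 * (E + K) ≤ H) (hF1 : mom F 1 = E) (hF2 : mom F 2 ≤ E + K) (hF6 : mom F 6 ≤ K)
    (hR : 1 ≤ R) (hRe : 2 * mom (high R F) 1 ≤ E) (hτ : 0 ≤ τ) (hτR : τ * ((8 * N + 1) * R ^ 5) ≤ 1)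
    (hτH : τ * ((6 * H + 2) * N) ≤ H / 2)
    (hτK : τ * (504 * (1 + 40320 * E) ^ 6 * E ^ 2) ≤ K / 4) :
    let V := fun r => low R F r + τ * coll (low R F) r
    Profile H V ∧ Integrable (fun r => V r * r ^ 1) ∧ Integrable (fun r => V r * r ^ 6) ∧
      mom V 1 = E - mom (high R F) 1 ∧ mom V 6 ≤ K - R ^ 5 / 4 * mom (high R F) 1 := by
  intro V
  have hG : FiniteProfile H N (low R F) := hF.low_finiteProfile
  have hcut : ∀ r, R < r → low R F r = 0 := fun r hr => if_neg (not_le.2 hr)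
  have s1 := hF.mom_low_add_high (R := R) (n := 1) (by norm_num)
  have s2 := hF.mom_low_add_high (R := R) (n := 2) (by norm_num)
  have s6 := hF.mom_low_add_high (R := R) (n := 6) (by norm_num)
  have t1 := hF.mom_high_le (R := R) (by linarith) (n := 1) (by norm_num)
  have nD1 := mom_nonneg (hF.high_finiteProfile (R := R)).toProfile 1
  have nD2 := mom_nonneg (hF.high_finiteProfile (R := R)).toProfile 2
  have nG6 := mom_nonneg hG.toProfile 6
  have hm := hG.meas
  have hmc := hG.measurable_coll
  set G := low R F with hGdef
  set D := high R F with hDdef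
  set P : ℝ := 504 * (1 + 40320 * E) ^ 6 * E ^ 2 with hP
  have hP0 : 0 ≤ P := by positivity
  have hH : 0 < H := by linarith
  obtain ⟨c1, e1⟩ := hG.coll_energy hcut
  have c6 := (hG.coll_sixth hcut).1
  obtain ⟨e6, e11⟩ := hG.coll_sixth_le hcut hE (by linarith)
  have i1 := hG.int 1 (by norm_num)
  have i6 := hG.int 6 le_rfl
  have hV1 : (fun r => V r * r ^ 1) = fun r => G r * r ^ 1 + τ * (coll G r * r) := by
    ext r; simp only [V]; ring
  have hV6 : (fun r => V r * r ^ 6) = fun r => G r * r ^ 6 + τ * (coll G r * r ^ 6) := by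
    ext r; simp only [V]; ring
  refine ⟨⟨hm.add (hmc.const_mul τ), fun r => ?_, fun r => ?_, fun r hr => ?_⟩, ?_, ?_, ?_, ?_⟩
  · have hg := mul_nonneg hτ (gainOp_nonneg hG.toProfile r)
    have hl : τ * (G r * lossRate G r) ≤ G r := by
      by_cases h0 : G r = 0
      · simp [h0]
      have h1 := hG.pos_of_ne h0
      have h2 : r ≤ R := not_lt.1 fun h => h0 (hcut r h)
      have h3 := mul_le_mul_of_nonneg_left (hG.lossRate_le h1.le h2 hR) hτ
      have := mul_le_mul_of_nonneg_left (h3.trans hτR) (hG.nonneg r)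
      linarith
    simp only [V, coll]
    linarith
  · simp only [V]
    rcases le_or_gt (H / 2) (G r) with h | h
    · have hr : 0 < r := hG.pos_of_ne (by linarith)
      have := hG.coll_nonpos (E := E) (K := E + K) hr h (by linarith) (by linarith) hH1 hH2
      have := mul_nonpos_of_nonneg_of_nonpos hτ this
      linarith [hG.le r]
    · have h0 : 0 ≤ τ * (G r * lossRate G r) := by
        by_cases h0 : G r = 0
        · simp [h0]
        have h1 := hG.pos_of_ne h0
        have h2 := integral_lossKer_nonneg hG.toProfile h1.le
        have h3 := hG.nonneg r
        unfold lossRate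
        positivity
      have := mul_le_mul_of_nonneg_left (hG.gainOp_le r) hτ
      simp only [coll]
      linarith
  · simp [V, coll, gainOp, not_lt.2 hr, show low R F r = 0 from hG.zero r hr]
  · rw [hV1]; exact i1.add (c1.const_mul τ)
  · rw [hV6]; exact i6.add (c6.const_mul τ)
  · rw [mom, hV1, integral_add i1 (c1.const_mul τ), integral_const_mul, e1]
    simp only [mom] at *
    linarith
  · rw [mom, hV6, integral_add i6 (c6.const_mul τ), integral_const_mul]
    change mom G 6 + _ ≤ _
    norm_num at t1
    rcases le_or_gt (K / 2) (mom G 6) with h | h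
    · have : ∫ r, coll G r * r ^ 6 ≤ 0 := by linarith
      have := mul_nonpos_of_nonneg_of_nonpos hτ this
      have : 0 ≤ R ^ 5 * mom D 1 := by positivity
      linarith
    · have n11 := mom_nonneg hG.toProfile 11
      have := mul_le_mul_of_nonneg_left (show ∫ r, coll G r * r ^ 6 ≤ P by linarith) hτ
      linarith

end FiniteProfile

/-- Restoring a small amount of missing energy far out, at a cost in mass that is much smaller. -/
lemma Profile.restore_energy {H : ℝ} {V : ℝ → ℝ} (hV : Profile H V) {E K e q ρ : ℝ}
    (i1 : Integrable fun r => V r * r ^ 1) (i6 : Integrable fun r => V r * r ^ 6)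
    (h1 : mom V 1 = E - e) (h6 : mom V 6 ≤ K - q * e) (he : 0 ≤ e) (hρ : 0 ≤ ρ)
    (hρE : E + 1 ≤ H * ρ) (hq : H * (ρ + 1) ^ 6 ≤ q) :
    ∃ W, Profile H W ∧ Integrable (fun r => W r * r ^ 1) ∧ Integrable (fun r => W r * r ^ 6) ∧
      mom W 1 = E ∧ mom W 6 ≤ K ∧ Integrable (fun r => V r - W r) ∧
      ∫ r, |V r - W r| ≤ e * ((2 * H + E) / (H * ρ - E)) := by
  have hH : 0 ≤ H := (hV.nonneg 0).trans (hV.le 0)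
  set B : ℝ → ℝ := (Ioc ρ (ρ + 1)).indicator fun _ => H with hB
  have hBm : Measurable B := measurable_const.indicator measurableSet_Ioc
  have hB0 : ∀ r, 0 ≤ B r := fun r => indicator_nonneg (fun _ _ => hH) r
  have hBH : ∀ r, B r ≤ H := fun r => by
    rw [hB]; unfold indicator; split_ifs; exacts [le_rfl, hH]
  have hBz : ∀ r, r ≤ 0 → B r = 0 := fun r hr =>
    indicator_of_notMem (fun h => by linarith [h.1]) _
  have hBi : ∀ n : ℕ, Integrable (fun r => B r * r ^ n) ∧
      H * ρ ^ n ≤ mom B n ∧ mom B n ≤ H * (ρ + 1) ^ n := by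
    intro n
    have e : (fun r => B r * r ^ n) = (Ioc ρ (ρ + 1)).indicator fun r => H * r ^ n := by
      ext r
      rw [hB]; unfold indicator; split_ifs <;> simp
    have hc : Continuous fun r : ℝ => H * r ^ n := by fun_prop
    have hi : IntegrableOn (fun r => H * r ^ n) (Ioc ρ (ρ + 1)) :=
      (hc.continuousOn.integrableOn_compact isCompact_Icc).mono_set Ioc_subset_Icc_self
    have hcst : ∀ c : ℝ, ∫ _ in Ioc ρ (ρ + 1), c = c := by
      intro c
      simp
    have hic : ∀ c : ℝ, IntegrableOn (fun _ => c) (Ioc ρ (ρ + 1)) := fun c => by simp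
    rw [mom, e, integrable_indicator_iff measurableSet_Ioc, integral_indicator measurableSet_Ioc]
    refine ⟨hi, ?_, ?_⟩
    · rw [← hcst (H * ρ ^ n)]
      refine setIntegral_mono_on (hic _) hi measurableSet_Ioc fun r hr => ?_
      have := hr.1.le
      gcongr
    · rw [← hcst (H * (ρ + 1) ^ n)]
      refine setIntegral_mono_on hi (hic _) measurableSet_Ioc fun r hr => ?_
      have := hr.2
      have : 0 ≤ r := hρ.trans hr.1.le
      gcongr
  obtain ⟨b1, l1, -⟩ := hBi 1
  obtain ⟨b6, -, u6⟩ := hBi 6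
  obtain ⟨b0, -, u0⟩ := hBi 0
  simp only [pow_zero, mul_one, pow_one] at b0 l1 u0
  obtain ⟨hVf, m0, -⟩ := hV.finiteProfile (E := E) (K := K) i1 i6 (by linarith) (by
    have : 0 ≤ q * e := mul_nonneg (le_trans (by positivity) hq) he
    linarith)
  have hVi := hVf.integrable
  have hV6 := mom_nonneg hV 6
  set A := mom B 1 - E + e with hA
  have hA1 : H * ρ - E ≤ A := by linarith
  have hApos : 0 < A := by linarith
  set θ := e / A with hθ
  have hθ0 : 0 ≤ θ := by positivity
  have hθ1 : θ ≤ 1 := (div_le_one hApos).2 (by linarith)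
  have hθe : θ ≤ e := div_le_self he (by linarith)
  have hθA : θ * A = e := div_mul_cancel₀ e hApos.ne'
  have hm := hV.meas
  have hW (n : ℕ) : (fun r => ((1 - θ) * V r + θ * B r) * r ^ n) =
      fun r => (1 - θ) * (V r * r ^ n) + θ * (B r * r ^ n) := by
    ext r; ring
  have hVW : (fun r => V r - ((1 - θ) * V r + θ * B r)) = fun r => θ * (V r - B r) := by
    ext r; ring
  refine ⟨fun r => (1 - θ) * V r + θ * B r,
    ⟨by fun_prop, fun r => ?_, fun r => ?_, fun r hr => ?_⟩, ?_, ?_, ?_, ?_, ?_, ?_⟩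
  · have := mul_nonneg (sub_nonneg.2 hθ1) (hV.nonneg r)
    have := mul_nonneg hθ0 (hB0 r)
    linarith
  · have := mul_le_mul_of_nonneg_left (hV.le r) (sub_nonneg.2 hθ1)
    have := mul_le_mul_of_nonneg_left (hBH r) hθ0
    linarith
  · simp [hV.zero r hr, hBz r hr]
  · rw [hW]; exact (i1.const_mul _).add ((hBi 1).1.const_mul _)
  · rw [hW]; exact (i6.const_mul _).add (b6.const_mul _)
  · rw [mom, hW, integral_add (i1.const_mul _) ((hBi 1).1.const_mul _), integral_const_mul,
      integral_const_mul]
    change (1 - θ) * mom V 1 + θ * mom B 1 = E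
    rw [h1]
    linear_combination hθA
  · rw [mom, hW, integral_add (i6.const_mul _) (b6.const_mul _), integral_const_mul,
      integral_const_mul]
    change (1 - θ) * mom V 6 + θ * mom B 6 ≤ K
    have a1 := mul_le_mul hθe (u6.trans hq) (mom_nonneg ⟨hBm, hB0, hBH, hBz⟩ 6) he
    have a2 := mul_nonneg hθ0 hV6
    linarith
  · rw [hVW]; exact (hVi.sub b0).const_mul θ
  · have h : ∀ r, V r - ((1 - θ) * V r + θ * B r) = θ * (V r - B r) := fun r => by ring
    simp only [h, abs_mul, abs_of_nonneg hθ0]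
    rw [integral_const_mul]
    have hle : ∫ r, |V r - B r| ≤ 2 * H + E := by
      have h := integral_mono (hVi.sub b0).abs (hVi.add b0) fun r => (by
        simp only [Pi.add_apply, Pi.sub_apply]
        rw [abs_le]
        constructor <;> linarith [hV.nonneg r, hB0 r] : |(V - B) r| ≤ (V + B) r)
      rw [integral_add' hVi b0] at h
      simp only [mom, pow_zero, mul_one] at m0 u0
      simp only [Pi.sub_apply] at h
      linarith
    calc θ * ∫ r, |V r - B r| ≤ θ * (2 * H + E) := by gcongr
      _ ≤ e / (H * ρ - E) * (2 * H + E) := by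
        have : 0 ≤ 2 * H + E := le_trans (integral_nonneg fun r => abs_nonneg _) hle
        have : 0 < H * ρ - E := by linarith
        rw [hθ]
        gcongr
      _ = e * ((2 * H + E) / (H * ρ - E)) := by ring

lemma FiniteProfile.pow_mul_mom_high_le {H N R K : ℝ} {F : ℝ → ℝ} (hF : FiniteProfile H N F)
    (hR : 1 ≤ R) (hF6 : mom F 6 ≤ K) {n k : ℕ} (hkn : k + n ≤ 6) :
    R ^ k * mom (high R F) n ≤ K := by
  have h1 := hF.mom_high_le (R := R) (by linarith) (n := n) (by omega)
  have h2 := hF.mom_low_add_high (R := R) (n := 6) le_rfl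
  have h3 := mom_nonneg (hF.low_finiteProfile (R := R)).toProfile 6
  have h4 := mom_nonneg (hF.high_finiteProfile (R := R)).toProfile n
  have h5 := mul_le_mul_of_nonneg_right (pow_le_pow_right₀ hR (show k ≤ 6 - n by omega)) h4
  linarith

lemma FiniteProfile.exists_near_euler_step {H N R : ℝ} {F : ℝ → ℝ} (hF : FiniteProfile H N F)
    {E K τ ρ : ℝ} (hE : 0 < E)
    (hK : 2 * (E + 80 * (504 * (1 + 40320 * E) ^ 6 * E ^ 2)) ≤ K) (hH1 : 4 * (E + K) ≤ H * E)
    (hH2 : 120 * (E + K) ≤ H) (hF1 : mom F 1 = E) (hF2 : mom F 2 ≤ E + K) (hF6 : mom F 6 ≤ K)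
    (hR : 1 ≤ R) (hRe : 2 * mom (high R F) 1 ≤ E) (hτ : 0 ≤ τ) (hτR : τ * ((8 * N + 1) * R ^ 5) ≤ 1)
    (hτH : τ * ((6 * H + 2) * N) ≤ H / 2)
    (hτK : τ * (504 * (1 + 40320 * E) ^ 6 * E ^ 2) ≤ K / 4)
    (hρ : 0 ≤ ρ) (hρE : E + 1 ≤ H * ρ) (hq : H * (ρ + 1) ^ 6 ≤ R ^ 5 / 4) :
    ∃ W, Profile H W ∧ Integrable (fun r => W r * r ^ 1) ∧ Integrable (fun r => W r * r ^ 6) ∧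
      mom W 1 = E ∧ mom W 6 ≤ K ∧
      ∫ r, |F r + τ * coll F r - W r| ≤ mom (high R F) 0 + τ * ((28 * N + 2) * (K / R)) +
        mom (high R F) 1 * ((2 * H + E) / (H * ρ - E)) := by
  have hG : FiniteProfile H N (low R F) := hF.low_finiteProfile
  have hD : FiniteProfile H N (high R F) := hF.high_finiteProfile
  have hμ : ∀ n ≤ 5, mom (high R F) n ≤ K / R := by
    intro n hn
    rw [le_div_iff₀' (by linarith)]
    simpa using hF.pow_mul_mom_high_le hR hF6 (n := n) (k := 1) (by omega)
  obtain ⟨hV, v1, v6, w1, w6⟩ :=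
    hF.euler_step hE hK hH1 hH2 hF1 hF2 hF6 hR hRe hτ hτR hτH hτK
  obtain ⟨W, hW, u1, u6, z1, z6, hVW, herr⟩ :=
    hV.restore_energy v1 v6 w1 w6 (mom_nonneg hD.toProfile 1) hρ hρE hq
  refine ⟨W, hW, u1, u6, z1, z6, ?_⟩
  obtain ⟨hci, hcerr⟩ := hF.integral_abs_coll_sub_le hG hD (low_add_high R F) hμ
  have j2 := hci.abs.const_mul τ
  have j12 : Integrable fun r => high R F r + τ * |coll F r - coll (low R F) r| :=
    hD.integrable.add j2
  have h : ∫ r, |F r + τ * coll F r - W r| ≤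
      ∫ r, (high R F r + τ * |coll F r - coll (low R F) r| +
        |low R F r + τ * coll (low R F) r - W r|) := by
    refine integral_mono_of_nonneg (ae_of_all _ fun r => abs_nonneg _)
      (j12.add hVW.abs) (ae_of_all _ fun r => ?_)
    have e : F r + τ * coll F r - W r = high R F r + τ * (coll F r - coll (low R F) r) +
        (low R F r + τ * coll (low R F) r - W r) := by
      linear_combination low_add_high R F r
    dsimp only
    rw [e]
    refine (abs_add_three _ _ _).trans_eq ?_
    rw [abs_of_nonneg (hD.nonneg r), abs_mul, abs_of_nonneg hτ]
  refine h.trans ?_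
  rw [integral_add j12 hVW.abs, integral_add hD.integrable j2, integral_const_mul]
  refine add_le_add (add_le_add (le_of_eq (by simp [mom])) ?_) herr
  exact mul_le_mul_of_nonneg_left hcerr hτ

/-- Every Euler step with a time step of order `R ^ (-5)` is close to an admissible density. -/
lemma exists_admissible_step {E K H η : ℝ} (hE : 0 < E)
    (hK : 2 * (E + 80 * (504 * (1 + 40320 * E) ^ 6 * E ^ 2)) ≤ K) (hH1 : 4 * (E + K) ≤ H * E)
    (hH2 : 120 * (E + K) ≤ H) (hη : 0 < η) :
    ∃ R₀ : ℝ, 1 ≤ R₀ ∧ ∀ R, R₀ ≤ R → ∀ F, Profile H F → Integrable (fun s => F s * s ^ 1) →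
      Integrable (fun s => F s * s ^ 6) → mom F 1 = E → mom F 6 ≤ K →
      ∀ τ, 0 ≤ τ → τ * ((8 * (H + E + K) + 1) * R ^ 5) ≤ 1 →
      ∃ W, Profile H W ∧ Integrable (fun r => W r * r ^ 1) ∧ Integrable (fun r => W r * r ^ 6) ∧
        mom W 1 = E ∧ mom W 6 ≤ K ∧ ∫ r, |F r + τ * coll F r - W r| ≤ η / R ^ 5 := by
  have hP0 : 0 ≤ 504 * (1 + 40320 * E) ^ 6 * E ^ 2 := by positivity
  have hK0 : 0 < K := by linarith
  have hH : 0 < H := by linarith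
  have hN0 : 0 < H + E + K := by positivity
  obtain ⟨ρ, hρ0, hρE, hratio⟩ : ∃ ρ : ℝ, 0 ≤ ρ ∧ E + 1 ≤ H * ρ ∧
      K * ((2 * H + E) / (H * ρ - E)) ≤ η / 2 := by
    have hy : 0 ≤ 2 * K * (2 * H + E) / η := by positivity
    have hHρ : H * ((E + 1 + 2 * K * (2 * H + E) / η) / H) = E + 1 + 2 * K * (2 * H + E) / η :=
      mul_div_cancel₀ _ hH.ne'
    refine ⟨(E + 1 + 2 * K * (2 * H + E) / η) / H, by positivity, by linarith, ?_⟩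
    rw [hHρ, ← mul_div_assoc, div_le_iff₀ (by linarith)]
    have : η * (2 * K * (2 * H + E) / η) = 2 * K * (2 * H + E) := mul_div_cancel₀ _ hη.ne'
    linarith
  obtain ⟨R₀, hR₀⟩ : ∃ R₀ : ℝ, ∀ R, R₀ ≤ R → 1 ≤ R ∧ 2 * K ≤ E * R ∧
      4 * (H * (ρ + 1) ^ 6) ≤ R ∧ 2 * ((6 * H + 2) * (H + E + K)) ≤ H * R ∧
      4 * (504 * (1 + 40320 * E) ^ 6 * E ^ 2) ≤ K * R ∧
      2 * (K + (28 * (H + E + K) + 2) * K) ≤ η * R := by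
    have hlin : ∀ a b : ℝ, 0 < b → ∀ᶠ R in atTop, a ≤ b * R := fun a b hb =>
      (tendsto_id.const_mul_atTop hb).eventually_ge_atTop a
    exact eventually_atTop.1 ((eventually_ge_atTop 1).and ((hlin _ _ hE).and
      ((eventually_ge_atTop _).and ((hlin _ _ hH).and ((hlin _ _ hK0).and (hlin _ _ hη))))))
  refine ⟨R₀, (hR₀ R₀ le_rfl).1, fun R hR F hF i1 i6 m1 m6 τ hτ hτR => ?_⟩
  obtain ⟨hR1, y1, y2, y3, y4, y5⟩ := hR₀ R hR
  obtain ⟨hFN, -, m2⟩ := hF.finiteProfile i1 i6 m1.le m6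
  set N : ℝ := H + E + K
  set P : ℝ := 504 * (1 + 40320 * E) ^ 6 * E ^ 2
  have hR0 : 0 < R := by linarith
  have hR5 : R ≤ R ^ 5 := le_self_pow₀ hR1 (by norm_num)
  have hτ5 : τ * R ^ 5 ≤ 1 := by
    have : 0 ≤ τ * R ^ 5 * N := by positivity
    linarith
  have hτ1 : τ * R ≤ 1 := (mul_le_mul_of_nonneg_left hR5 hτ).trans hτ5
  have nD := mom_nonneg (hFN.high_finiteProfile (R := R)).toProfile
  have hD0 := hFN.pow_mul_mom_high_le hR1 m6 (n := 0) (k := 6) (by norm_num)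
  have hD1 := hFN.pow_mul_mom_high_le hR1 m6 (n := 1) (k := 5) (by norm_num)
  have hRe : 2 * mom (high R F) 1 ≤ E := by
    have := (mul_le_mul_of_nonneg_right hR5 (nD 1)).trans hD1
    refine le_of_mul_le_mul_left ?_ hR0
    linarith
  have hτH : τ * ((6 * H + 2) * N) ≤ H / 2 := by
    have := mul_le_mul_of_nonneg_left y3 hτ
    have := mul_le_mul_of_nonneg_left hτ1 hH.le
    linarith
  have hτK : τ * P ≤ K / 4 := by
    have := mul_le_mul_of_nonneg_left y4 hτ
    have := mul_le_mul_of_nonneg_left hτ1 hK0.le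
    linarith
  obtain ⟨W, hW, u1, u6, z1, z6, herr⟩ := hFN.exists_near_euler_step hE hK hH1 hH2 m1 m2 m6 hR1 hRe
    hτ hτR hτH hτK hρ0 hρE (by linarith)
  refine ⟨W, hW, u1, u6, z1, z6, herr.trans ?_⟩
  have hR5p : 0 < R ^ 5 := by positivity
  rw [le_div_iff₀' hR5p]
  have a1 : R ^ 5 * mom (high R F) 0 ≤ K / R := by
    rw [le_div_iff₀' hR0]; linarith
  have a2 : τ * R ^ 5 * ((28 * N + 2) * (K / R)) ≤ 1 * ((28 * N + 2) * (K / R)) :=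
    mul_le_mul_of_nonneg_right hτ5 (by positivity)
  have a3 : R ^ 5 * mom (high R F) 1 * ((2 * H + E) / (H * ρ - E)) ≤ η / 2 :=
    (mul_le_mul_of_nonneg_right hD1 (div_nonneg (by positivity) (by linarith))).trans hratio
  have a4 : K / R + (28 * N + 2) * (K / R) ≤ η / 2 := by
    rw [← mul_div_assoc, ← add_div, div_le_iff₀ hR0]; linarith
  linarith

lemma memS_of_profile {E K H : ℝ} {W : ℝ → ℝ} (hW : Profile H W)
    (i1 : Integrable fun r => W r * r ^ 1) (i6 : Integrable fun r => W r * r ^ 6)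
    (m1 : mom W 1 = E) (m6 : mom W 6 ≤ K) : memS E K H fun r => W r / r ^ 2 := by
  have key : ∀ (n : ℕ) (k : ℝ), k = n + 2 → Integrable (fun r => W r * r ^ n) →
      IntegrableOn (fun r => W r / r ^ 2 * r ^ k) (Ioi (0 : ℝ)) ∧
      lm (fun r => W r / r ^ 2) k = mom W n := by
    intro n k hk hi
    have e : (Ioi (0 : ℝ)).indicator (fun r => W r / r ^ 2 * r ^ k) = fun r => W r * r ^ n := by
      ext r
      by_cases h : 0 < r
      · rw [indicator_of_mem (mem_Ioi.2 h), hk,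
          show (n : ℝ) + 2 = ((n + 2 : ℕ) : ℝ) by push_cast; rfl, rpow_natCast]
        field_simp
        ring
      · rw [indicator_of_notMem (by simpa using h), hW.zero r (not_lt.1 h), zero_mul]
    rw [← integrable_indicator_iff measurableSet_Ioi, lm, ← integral_indicator measurableSet_Ioi, e]
    exact ⟨hi, rfl⟩
  obtain ⟨a3, b3⟩ := key 1 3 (by norm_num) i1
  obtain ⟨a8, b8⟩ := key 6 8 (by norm_num) i6
  have hm := hW.meas
  refine ⟨by fun_prop, fun r => div_nonneg (hW.nonneg r) (sq_nonneg r), a3, b3.trans m1, a8,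
    b8.le.trans m6, (ae_restrict_iff' measurableSet_Ioi).2 (ae_of_all _ fun r hr => ?_)⟩
  rw [div_mul_cancel₀ _ (pow_ne_zero 2 (ne_of_gt hr))]
  exact hW.le r

/-- The sub-tangent property for a single element of the invariant set, uniformly in the
relaxation rate `c`. -/
lemma memS_subtangent {E K H ε Λ : ℝ} (hE : 0 < E)
    (hK : 2 * (E + 80 * (504 * (1 + 40320 * E) ^ 6 * E ^ 2)) ≤ K) (hH1 : 4 * (E + K) ≤ H * E)
    (hH2 : 120 * (E + K) ≤ H) (hε : 0 < ε) (hΛ : 0 < Λ) :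
    ∃ hstar : ℝ, 0 < hstar ∧ ∀ h : ℝ, 0 < h → h < hstar → ∀ c : ℝ, 0 ≤ c → c ≤ Λ →
      ∀ f : ℝ → ℝ, memS E K H f → ∃ w : ℝ → ℝ, memS E K H w ∧
        4 * π * (∫ r in Ioi (0 : ℝ), |f r + h * c * (Qcol f r / (4 * π * r ^ 2)) - w r| * r ^ 2) ≤
          h * ε := by
  have hP0 : 0 ≤ 504 * (1 + 40320 * E) ^ 6 * E ^ 2 := by positivity
  have hH : 0 < H := by linarith
  have hK0 : 0 < K := by linarith
  set C : ℝ := 8 * (H + E + K) + 1 with hC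
  have hC0 : 0 < C := by positivity
  set b : ℝ := 2 * π * Λ * C with hb
  have hb0 : 0 < b := by positivity
  obtain ⟨R₀, hR₀, hstep⟩ := exists_admissible_step (η := ε / (4 * π * b)) hE hK hH1 hH2
    (by positivity)
  refine ⟨1 / (b * R₀ ^ 5), by positivity, ?_⟩
  intro h hh hhs c hc hcΛ f hf
  obtain ⟨fm, f0, f3, l3, f8, l8, fle⟩ := hf
  set R : ℝ := (1 / (h * b)) ^ (1 / 5 : ℝ) with hR
  have hR5 : R ^ 5 = 1 / (h * b) := by
    rw [hR, ← rpow_natCast, ← rpow_mul (by positivity)]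
    norm_num
  have hRR : R₀ ≤ R := by
    refine le_of_pow_le_pow_left₀ (n := 5) (by norm_num) (by positivity) ?_
    rw [hR5, le_div_iff₀ (by positivity)]
    rw [lt_div_iff₀ (by positivity)] at hhs
    linarith
  have hF := density_profile hH.le fm f0
  obtain ⟨i1, m1⟩ := density_mom fle 1 (k := 3) (by norm_num) f3
  obtain ⟨i6, m6⟩ := density_mom fle 6 (k := 8) (by norm_num) f8
  rw [l3] at m1
  rw [← m6] at l8
  have hFN := (hF.finiteProfile i1 i6 m1.le l8).1
  obtain ⟨W, hW, u1, u6, z1, z6, herr⟩ := hstep R hRR _ hF i1 i6 m1 l8 (h * (2 * π * c))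
    (by positivity) (by
      rw [hR5]
      have : h * (2 * π * c) * (C * (1 / (h * b))) = c / Λ := by
        rw [hb]; field_simp
      rw [this]
      exact (div_le_one hΛ).2 hcΛ)
  refine ⟨_, memS_of_profile hW u1 u6 z1 z6, ?_⟩
  have hle :
      ∫ r in Ioi (0 : ℝ), |f r + h * c * (Qcol f r / (4 * π * r ^ 2)) - W r / r ^ 2| * r ^ 2 ≤
      ∫ r, |density H f r + h * (2 * π * c) * coll (density H f) r - W r| := by
    have hz : ∀ r, r ∉ Ioi (0 : ℝ) →
        |density H f r + h * (2 * π * c) * coll (density H f) r - W r| = 0 := by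
      intro r hr
      have hr' : r ≤ 0 := not_lt.1 hr
      simp [coll, gainOp, not_lt.2 hr', hF.zero r hr', hW.zero r hr']
    rw [← setIntegral_eq_integral_of_forall_compl_eq_zero hz]
    refine (setIntegral_congr_ae measurableSet_Ioi ?_).le
    filter_upwards [density_ae fle] with r hfr hr
    have hr0 : 0 < r := hr
    rw [Qcol_eq hFN fle hr0 (hfr hr), hfr hr, ← abs_of_pos (show 0 < r ^ 2 by positivity),
      ← abs_mul, abs_of_pos (show 0 < r ^ 2 by positivity)]
    congr 1
    field_simp
    ring
  calc _ ≤ 4 * π * (ε / (4 * π * b) / R ^ 5) := by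
        have := hle.trans herr
        gcongr
    _ = h * ε := by
        rw [hR5]; field_simp

end RadialCollision

/-- Sub-tangent condition. -/
theorem subtangent_condition (mass h3 δ : ℝ) (hmass : 0 < mass) (h3p : 0 < h3) (hδ : 0 < δ) :
    ∃ H8 : ℝ, 0 < H8 ∧ ∀ h8 : ℝ, H8 ≤ h8 →
    ∃ Hinf : ℝ, 0 < Hinf ∧ ∀ hinf : ℝ, Hinf ≤ hinf →
      ∀ T : ℝ, 0 < T → ∀ n0 : ℝ, 0 < n0 →
      ∀ f : ℝ → ℝ → ℝ,
        (∀ t ∈ Icc (0 : ℝ) T, memS h3 h8 hinf (f t)) → contS T f →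
        (∀ t ∈ Icc (0 : ℝ) T, δ ≤ ncF mass n0 f t) →
        ∀ ε : ℝ, 0 < ε → ∃ hstar : ℝ, 0 < hstar ∧
          ∀ h : ℝ, 0 < h → h < hstar → ∀ t ∈ Icc (0 : ℝ) T,
            ∃ w : ℝ → ℝ, memS h3 h8 hinf w ∧
              4 * π * (∫ r in Ioi (0 : ℝ),
                  |f t r + h * (kappa0 mass / ncF mass n0 f t) *
                      (Qcol (f t) r / (4 * π * r ^ 2)) - w r| * r ^ 2) ≤ h * ε := by
  refine ⟨2 * (h3 + 80 * (504 * (1 + 40320 * h3) ^ 6 * h3 ^ 2)), by positivity,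
    fun h8 hh8 => ?_⟩
  have h8p : 0 < h8 := lt_of_lt_of_le (by positivity) hh8
  refine ⟨120 * (h3 + h8) + 4 * (h3 + h8) / h3, by positivity, fun hinf hhinf => ?_⟩
  have hnn : 0 ≤ 4 * (h3 + h8) / h3 := by positivity
  have hinf1 : 4 * (h3 + h8) ≤ hinf * h3 := (div_le_iff₀ h3p).1 (by linarith)
  have hinf2 : 120 * (h3 + h8) ≤ hinf := by linarith
  have hκ : 0 < kappa0 mass := by unfold kappa0; positivity
  intro T _ n0 _ f hf _ hnc ε hε
  obtain ⟨hstar, hpos, hw⟩ := RadialCollision.memS_subtangent h3p hh8 hinf1 hinf2 hε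
    (div_pos hκ hδ)
  refine ⟨hstar, hpos, fun h hh hlt t ht => ?_⟩
  have hn : 0 < ncF mass n0 f t := hδ.trans_le (hnc t ht)
  exact hw h hh hlt _ (by positivity)
    (div_le_div_of_nonneg_left hκ.le hδ (hnc t ht)) (f t) (hf t ht)
end

section
/- Moment partial-sum comparison: Let a ∈ [1,∞), α > 0, and let f : ℝ³ → [0,∞) be measurable with finite moments ℳ_k := ∫_{ℝ³} f(p)|p|^k dp for all integers k ≥ 1. Then for every n ≥ 1: ∑_{k=1}^n ℳ_{k+5} · α^{ak}/Γ(ak+1) ≥ α^{−5/2} ∑_{k=1}^n ℳ_k · α^{ak}/Γ(ak+1) − α^{−2} · ℳ₁ · E_a( α^{a−1/2} ), where E_a(x) := ∑_{k=1}^∞ x^k/Γ(ak+1). -/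
open Real Finset MeasureTheory

/-- The (shifted) Mittag-Leffler function `E_a(x) = ∑_{k≥1} x^k / Γ(ak+1)`. -/
noncomputable def Ea (a x : ℝ) : ℝ := ∑' k : ℕ, x ^ (k + 1) / Real.Gamma (a * (k + 1) + 1)

theorem summable_Ea {a x : ℝ} (ha : 1 ≤ a) (hx : 0 ≤ x) :
    Summable fun k : ℕ => x ^ (k + 1) / Real.Gamma (a * (k + 1) + 1) := by
  have hexp : Summable fun k : ℕ => x ^ (k + 1) / ((k + 1).factorial : ℝ) :=
    (summable_nat_add_iff 1).2 (Real.summable_pow_div_factorial x)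
  refine Summable.of_nonneg_of_le (fun k => ?_) (fun k => ?_) hexp
  · exact div_nonneg (by positivity) (Real.Gamma_pos_of_pos (by positivity)).le
  · have hk : (0 : ℝ) ≤ k := k.cast_nonneg
    have hle : (k : ℝ) + 1 ≤ a * (k + 1) := by nlinarith
    have hmono : Real.Gamma (((k + 1 : ℕ) : ℝ) + 1) ≤ Real.Gamma (a * (k + 1) + 1) := by
      apply Real.Gamma_strictMonoOn_Ici.monotoneOn
      · simp only [Set.mem_Ici]; push_cast; linarith
      · simp only [Set.mem_Ici]; linarith
      · push_cast; linarith
    rw [Real.Gamma_nat_eq_factorial] at hmono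
    gcongr

theorem sum_Icc_le_Ea {a x : ℝ} (ha : 1 ≤ a) (hx : 0 ≤ x) (n : ℕ) :
    ∑ k ∈ Finset.Icc 1 n, x ^ k / Real.Gamma (a * k + 1) ≤ Ea a x := by
  have hsum : ∑ k ∈ Finset.Icc 1 n, x ^ k / Real.Gamma (a * k + 1) =
      ∑ k ∈ Finset.range n, x ^ (k + 1) / Real.Gamma (a * (k + 1) + 1) := by
    rw [Finset.range_eq_Ico, ← Finset.Ico_add_one_right_eq_Icc,
      ← Finset.sum_Ico_add' (fun k : ℕ => x ^ k / Real.Gamma (a * k + 1)) 0 n 1]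
    simp
  rw [hsum]
  refine (summable_Ea ha hx).sum_le_tsum _ fun k _ => ?_
  exact div_nonneg (by positivity) (Real.Gamma_pos_of_pos (by positivity)).le

theorem mul_pow_sub_le_pow_add_five {r t : ℝ} (hr : 0 ≤ r) (ht : 0 ≤ t) (m : ℕ) :
    r ^ 5 * t ^ (m + 1) - r ^ (m + 5) * t ≤ t ^ (m + 6) := by
  rcases le_total r t with h | h
  · have h5 : r ^ 5 * t ^ (m + 1) ≤ t ^ 5 * t ^ (m + 1) := by gcongr
    have hpos : 0 ≤ r ^ (m + 5) * t := by positivity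
    calc _ ≤ t ^ 5 * t ^ (m + 1) := by linarith
      _ = t ^ (m + 6) := by ring
  · have hm : r ^ 5 * t * t ^ m ≤ r ^ 5 * t * r ^ m := by gcongr
    calc _ = r ^ 5 * t * t ^ m - r ^ 5 * t * r ^ m := by ring
      _ ≤ 0 := by linarith
      _ ≤ t ^ (m + 6) := by positivity

theorem moment_add_five_ge {E : Type*} [NormedAddCommGroup E] [MeasurableSpace E]
    {μ : Measure E} {f : E → ℝ} (h0 : ∀ p, 0 ≤ f p)
    (hmom : ∀ k : ℕ, 1 ≤ k → Integrable (fun p => f p * ‖p‖ ^ k) μ)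
    {r : ℝ} (hr : 0 ≤ r) {k : ℕ} (hk : 1 ≤ k) :
    r ^ 5 * (∫ p, f p * ‖p‖ ^ k ∂μ) - r ^ (k + 4) * (∫ p, f p * ‖p‖ ∂μ) ≤
      ∫ p, f p * ‖p‖ ^ (k + 5) ∂μ := by
  obtain ⟨m, rfl⟩ := Nat.exists_eq_add_of_le' hk
  have h1 : Integrable (fun p => f p * ‖p‖) μ := by simpa using hmom 1 le_rfl
  have hm := hmom (m + 1) hk
  rw [← integral_const_mul, ← integral_const_mul,
    ← integral_sub (hm.const_mul _) (h1.const_mul _)]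
  refine integral_mono ((hm.const_mul _).sub (h1.const_mul _)) (hmom _ (by omega)) fun p => ?_
  calc _ = f p * (r ^ 5 * ‖p‖ ^ (m + 1) - r ^ (m + 5) * ‖p‖) := by ring
    _ ≤ f p * ‖p‖ ^ (m + 6) :=
      mul_le_mul_of_nonneg_left (mul_pow_sub_le_pow_add_five hr (norm_nonneg p) m) (h0 p)

/-- Moment partial-sum comparison. -/
theorem moment_partial_sum_comparison (a : ℝ) (ha : 1 ≤ a) (α : ℝ) (hα : 0 < α)
    (f : EuclideanSpace ℝ (Fin 3) → ℝ) (hmeas : Measurable f) (h0 : ∀ p, 0 ≤ f p)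
    (hmom : ∀ k : ℕ, 1 ≤ k → Integrable (fun p => f p * ‖p‖ ^ k)) :
    ∀ n : ℕ, 1 ≤ n →
      (∑ k ∈ Finset.Icc 1 n,
          (∫ p, f p * ‖p‖ ^ (k + 5)) * α ^ (a * k) / Real.Gamma (a * k + 1)) ≥
        α ^ (-(5 : ℝ) / 2) *
            (∑ k ∈ Finset.Icc 1 n,
              (∫ p, f p * ‖p‖ ^ k) * α ^ (a * k) / Real.Gamma (a * k + 1)) -
          α ^ (-(2 : ℝ)) * (∫ p, f p * ‖p‖) * Ea a (α ^ (a - 1 / 2)) := by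
  intro n _
  set r : ℝ := α ^ (-(1 : ℝ) / 2) with hr
  set M := ∫ p, f p * ‖p‖
  have hM0 : 0 ≤ M := integral_nonneg fun p => mul_nonneg (h0 p) (norm_nonneg p)
  have hr5 : α ^ (-(5 : ℝ) / 2) = r ^ 5 := by
    rw [hr, ← Real.rpow_mul_natCast hα.le]; norm_num
  have hpow (k : ℕ) : r ^ (k + 4) * α ^ (a * k) = α ^ (-(2 : ℝ)) * (α ^ (a - 1 / 2)) ^ k := by
    rw [hr, ← Real.rpow_mul_natCast hα.le, ← Real.rpow_mul_natCast hα.le, ← Real.rpow_add hα,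
      ← Real.rpow_add hα]
    congr 1
    push_cast
    ring
  have hEa : α ^ (-(2 : ℝ)) * M *
      (∑ k ∈ Finset.Icc 1 n, (α ^ (a - 1 / 2)) ^ k / Real.Gamma (a * k + 1)) ≤
      α ^ (-(2 : ℝ)) * M * Ea a (α ^ (a - 1 / 2)) :=
    mul_le_mul_of_nonneg_left (sum_Icc_le_Ea ha (by positivity) n) (by positivity)
  refine ge_iff_le.2 ((sub_le_sub_left hEa _).trans ?_)
  rw [Finset.mul_sum, Finset.mul_sum, ← Finset.sum_sub_distrib, hr5]
  refine Finset.sum_le_sum fun k hk => ?_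
  have hΓ : 0 < Real.Gamma (a * k + 1) := Real.Gamma_pos_of_pos (by positivity)
  calc _ = (r ^ 5 * (∫ p, f p * ‖p‖ ^ k) * α ^ (a * k) -
          α ^ (-(2 : ℝ)) * (α ^ (a - 1 / 2)) ^ k * M) / Real.Gamma (a * k + 1) := by ring
    _ = (r ^ 5 * (∫ p, f p * ‖p‖ ^ k) - r ^ (k + 4) * M) * α ^ (a * k) /
          Real.Gamma (a * k + 1) := by rw [← hpow]; ring
    _ ≤ _ := by
      gcongr
      exact moment_add_five_ge h0 hmom (by positivity) (Finset.mem_Icc.1 hk).1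
end
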